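/- arXiv:2403.17274 — 4 statements merged into one kernel-verified Lean document; each statement's English description precedes it below -/
import Mathlib

section
/- Let Φ be an irreducible crystallographic root system that is not of type G₂. Then a subset Σ ⊆ Φ⁺ is negatively coclosed if and only if Σ is 2-locally simple. -/
open scoped InnerProductSpace

noncomputable section

/-- Ambient Euclidean space `ℝ^ℓ` with the standard inner product. -/
abbrev EucV (ℓ : ℕ) : Type := EuclideanSpace ℝ (Fin ℓ)

variable {ℓ : ℕ}

/-- `α` is a nonnegative integer combination of elements of `D`. -/
def IsNNIntComb (D : Set (EucV ℓ)) (α : EucV ℓ) : Prop :=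
  ∃ (s : Finset (EucV ℓ)) (c : EucV ℓ → ℕ), (↑s : Set (EucV ℓ)) ⊆ D ∧
    α = ∑ b ∈ s, (c b : ℝ) • b

/-- Data of a reduced crystallographic root system `Φ` spanning `ℝ^ℓ`, together with a
fixed simple system `Δ` (every root is a nonnegative or nonpositive integer
combination of `Δ`). -/
structure RootSystemData (ℓ : ℕ) where
  Φ : Set (EucV ℓ)
  Δ : Set (EucV ℓ)
  finite : Φ.Finite
  nonzero : (0 : EucV ℓ) ∉ Φ
  spanning : Submodule.span ℝ Φ = ⊤
  neg_mem : ∀ α ∈ Φ, -α ∈ Φ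
  reduced : ∀ α ∈ Φ, ∀ t : ℝ, t • α ∈ Φ → t = 1 ∨ t = -1
  cryst : ∀ α ∈ Φ, ∀ β ∈ Φ, ∃ n : ℤ, 2 * ⟪β, α⟫_ℝ = (n : ℝ) * ⟪α, α⟫_ℝ
  refl_mem : ∀ α ∈ Φ, ∀ β ∈ Φ, β - (2 * ⟪β, α⟫_ℝ / ⟪α, α⟫_ℝ) • α ∈ Φ
  simple_sub : Δ ⊆ Φ
  simple_indep : LinearIndependent ℝ (fun a : Δ => (a : EucV ℓ))
  pos_or_neg : ∀ α ∈ Φ, IsNNIntComb Δ α ∨ IsNNIntComb Δ (-α)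

/-- A set of vectors is irreducible if it admits no decomposition into two nonempty
mutually orthogonal parts. -/
def IrredSet (S : Set (EucV ℓ)) : Prop :=
  ¬ ∃ S₁ S₂ : Set (EucV ℓ), S₁.Nonempty ∧ S₂.Nonempty ∧ S = S₁ ∪ S₂ ∧
      ∀ a ∈ S₁, ∀ b ∈ S₂, ⟪a, b⟫_ℝ = 0

namespace RootSystemData

variable (rs : RootSystemData ℓ)

/-- The positive system `Φ⁺` determined by the simple system `Δ`. -/
def Pos : Set (EucV ℓ) := {α ∈ rs.Φ | IsNNIntComb rs.Δ α}

/-- `X` is a codimension-two intersection of reflecting hyperplanes of `Φ`. -/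
def IsCodim2Flat (X : Set (EucV ℓ)) : Prop :=
  ∃ α ∈ rs.Pos, ∃ β ∈ rs.Pos, (¬ ∃ t : ℝ, β = t • α) ∧
    X = {x : EucV ℓ | ⟪α, x⟫_ℝ = 0 ∧ ⟪β, x⟫_ℝ = 0}

/-- The localization `Φ_X = Φ ∩ X^⊥`. -/
def locΦ (X : Set (EucV ℓ)) : Set (EucV ℓ) := {γ ∈ rs.Φ | ∀ x ∈ X, ⟪γ, x⟫_ℝ = 0}

/-- The positive system `Φ⁺_X = Φ⁺ ∩ Φ_X` of the localization. -/
def locPos (X : Set (EucV ℓ)) : Set (EucV ℓ) := rs.Pos ∩ rs.locΦ X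

/-- The (two-dimensional) linear span of the localization `Φ_X`, as a set. -/
def locSpan (X : Set (EucV ℓ)) : Set (EucV ℓ) :=
  (Submodule.span ℝ (rs.locΦ X) : Set (EucV ℓ))

end RootSystemData

/-- The indecomposable elements of a positive system `P`; for a positive system of a
root (sub)system this is the associated simple system. -/
def simplesOf (P : Set (EucV ℓ)) : Set (EucV ℓ) :=
  {α ∈ P | ¬ ∃ β ∈ P, ∃ γ ∈ P, α = β + γ}

/-- The simple system `Δ_X` of the localization `Φ_X` associated to `Φ⁺_X`. -/
def RootSystemData.locΔ (rs : RootSystemData ℓ) (X : Set (EucV ℓ)) : Set (EucV ℓ) :=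
  simplesOf (rs.locPos X)

/-- The union of the affine hyperplanes `H_α^n` (`α ∈ P`, `n ∈ ℤ`), traced on the
carrier set `U`. -/
def hypUnion (U P : Set (EucV ℓ)) : Set (EucV ℓ) :=
  {x ∈ U | ∃ α ∈ P, ∃ n : ℤ, ⟪α, x⟫_ℝ = (n : ℝ)}

/-- `A` is an alcove: a connected component of the complement (in the carrier `U`)
of all the affine hyperplanes `H_α^n`, `α ∈ P`, `n ∈ ℤ`. -/
def IsAlcove (U P A : Set (EucV ℓ)) : Prop :=
  ∃ x ∈ U \ hypUnion U P, A = connectedComponentIn (U \ hypUnion U P) x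

/-- `r` is the address of the alcove `A`: for each `γ ∈ P` and `x ∈ A` one has
`r γ - 1 < ⟪γ, x⟫ < r γ`. -/
def IsAddress (P A : Set (EucV ℓ)) (r : EucV ℓ → ℤ) : Prop :=
  ∀ γ ∈ P, ∀ x ∈ A, ((r γ : ℝ) - 1 < ⟪γ, x⟫_ℝ ∧ ⟪γ, x⟫_ℝ < (r γ : ℝ))

/-- The upper closure `A^◊` of an alcove `A` with address `r`. -/
def upperClos (P A : Set (EucV ℓ)) (r : EucV ℓ → ℤ) : Set (EucV ℓ) :=
  {x ∈ closure A | ∀ γ ∈ P, (r γ : ℝ) - 1 < ⟪γ, x⟫_ℝ}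

/-- The hyperplane `H_β^m` (traced on the carrier `U`) is a wall of the alcove `A`,
i.e. it supports a facet of `closure A`: its intersection with `closure A` affinely
spans the whole trace of the hyperplane on `U`. -/
def IsWall (U : Set (EucV ℓ)) (β : EucV ℓ) (m : ℤ) (A : Set (EucV ℓ)) : Prop :=
  ∀ y ∈ U, ⟪β, y⟫_ℝ = (m : ℝ) →
    y ∈ affineSpan ℝ ({x ∈ U | ⟪β, x⟫_ℝ = (m : ℝ)} ∩ closure A)

/-- The fundamental parallelepiped `P^◊` determined by the simple system `D`,
traced on the carrier `U`. -/
def fundPar (U D : Set (EucV ℓ)) : Set (EucV ℓ) :=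
  {x ∈ U | ∀ a ∈ D, 0 < ⟪a, x⟫_ℝ ∧ ⟪a, x⟫_ℝ ≤ 1}

/-- Worpitzky-compatibility of `S` (inside carrier `U`, with positive system `P` and
simple system `D`): for every alcove `A ⊆ P^◊`, every `α ∈ S` and every `n ∈ ℤ`, the
intersection `A^◊ ∩ H_α^n` is empty or contained in a ceiling `H_β^m` of `A`
(a wall with `m = r(A,β) ≥ 1`) with `β ∈ S`. -/
def WCompat (U P D S : Set (EucV ℓ)) : Prop :=
  ∀ A : Set (EucV ℓ), IsAlcove U P A → A ⊆ fundPar U D →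
    ∀ r : EucV ℓ → ℤ, IsAddress P A r →
      ∀ α ∈ S, ∀ n : ℤ,
        upperClos P A r ∩ {x : EucV ℓ | ⟪α, x⟫_ℝ = (n : ℝ)} = ∅ ∨
        ∃ β ∈ S, ∃ m : ℤ, m = r β ∧ 1 ≤ m ∧ IsWall U β m A ∧
          upperClos P A r ∩ {x : EucV ℓ | ⟪α, x⟫_ℝ = (n : ℝ)} ⊆
            {x : EucV ℓ | ⟪β, x⟫_ℝ = (m : ℝ)}

/-- `S` is 2-locally (Worpitzky-)compatible: for every codimension-two flat `X` with
`Φ_X` irreducible, the localization `S ∩ Φ⁺_X` is Worpitzky-compatible in `Φ_X`,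
inside the two-dimensional span of `Φ_X`, with respect to `Δ_X`. -/
def TwoLocallyCompat (rs : RootSystemData ℓ) (S : Set (EucV ℓ)) : Prop :=
  ∀ X : Set (EucV ℓ), rs.IsCodim2Flat X → IrredSet (rs.locΦ X) →
    WCompat (rs.locSpan X) (rs.locPos X) (rs.locΔ X) (S ∩ rs.locPos X)

/-- `S` is 2-locally simple: for every codimension-two flat `X` with `Φ_X`
irreducible, either `S ∩ Φ⁺_X` contains a simple root of `Φ_X` or it is empty. -/
def TwoLocallySimple (rs : RootSystemData ℓ) (S : Set (EucV ℓ)) : Prop :=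
  ∀ X : Set (EucV ℓ), rs.IsCodim2Flat X → IrredSet (rs.locΦ X) →
    ((S ∩ rs.locPos X) ∩ rs.locΔ X).Nonempty ∨ S ∩ rs.locPos X = ∅

/-- `S` is negatively coclosed in the positive system `P`. -/
def NegCoclosed (P S : Set (EucV ℓ)) : Prop :=
  ∀ α ∈ S, ∀ β₁ ∈ P, ∀ β₂ ∈ P, ∀ d₁ d₂ : ℤ, 0 < d₁ → 0 < d₂ →
    α = (d₁ : ℝ) • β₁ + (d₂ : ℝ) • β₂ → ⟪β₁, β₂⟫_ℝ < 0 → β₁ ∈ S ∨ β₂ ∈ S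

/-- `S` is coclosed in the positive system `P`. -/
def Coclosed (P S : Set (EucV ℓ)) : Prop :=
  ∀ α ∈ S, ∀ β₁ ∈ P, ∀ β₂ ∈ P, ∀ d₁ d₂ : ℤ, 0 < d₁ → 0 < d₂ →
    α = (d₁ : ℝ) • β₁ + (d₂ : ℝ) • β₂ → β₁ ∈ S ∨ β₂ ∈ S

/-- The root order: `β ≤ γ` iff `γ - β` is a nonnegative integer combination of the
simple roots in `D`. -/
def rootLE (D : Set (EucV ℓ)) (β γ : EucV ℓ) : Prop := IsNNIntComb D (γ - β)

/-- The defining recursion (on `Φ⁺`) for the function `r` of Lemma 3.8, with respect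
to `Δ_X = {γ₁, γ₂}`:
(i) `r β = 1` if `β ∈ Δ` or `β ≤ γ₁` or `β ≤ γ₂`;
(ii) if `β ∉ Δ`, `β ≰ γ₁`, `β ≰ γ₂` and `β - γᵢ ∈ Φ⁺` for `i = 1` or `2`, then
`r β = r (β - γᵢ) + 1`;
(iii) otherwise `r β = max { r (β - α) : α ∈ Δ, β - α ∈ Φ⁺ }`. -/
def AddrSpec (rs : RootSystemData ℓ) (γ₁ γ₂ : EucV ℓ) (r : EucV ℓ → ℤ) : Prop :=
  (∀ β ∈ rs.Pos, (β ∈ rs.Δ ∨ rootLE rs.Δ β γ₁ ∨ rootLE rs.Δ β γ₂) → r β = 1) ∧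
  (∀ β ∈ rs.Pos, β ∉ rs.Δ → ¬ rootLE rs.Δ β γ₁ → ¬ rootLE rs.Δ β γ₂ →
    ((β - γ₁ ∈ rs.Pos → r β = r (β - γ₁) + 1) ∧
     (β - γ₂ ∈ rs.Pos → r β = r (β - γ₂) + 1))) ∧
  (∀ β ∈ rs.Pos, β ∉ rs.Δ → ¬ rootLE rs.Δ β γ₁ → ¬ rootLE rs.Δ β γ₂ →
    β - γ₁ ∉ rs.Pos → β - γ₂ ∉ rs.Pos →
    ∃ α ∈ rs.Δ, β - α ∈ rs.Pos ∧ r β = r (β - α) ∧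
      ∀ α' ∈ rs.Δ, β - α' ∈ rs.Pos → r (β - α') ≤ r (β - α))

theorem aux_height (rs : RootSystemData ℓ) :
    ∃ h : EucV ℓ →ₗ[ℝ] ℝ, ∀ α ∈ rs.Pos, ∃ n : ℕ, 1 ≤ n ∧ h α = n := by
  have hli : LinearIndepOn ℝ id rs.Δ := rs.simple_indep
  let b := Module.Basis.extend hli
  let h : EucV ℓ →ₗ[ℝ] ℝ := b.constr ℝ (fun _ => (1 : ℝ))
  have hΔ : ∀ d ∈ rs.Δ, h d = 1 := by
    intro d hd
    have hd' : d ∈ hli.extend (Set.subset_univ _) := hli.subset_extend _ hd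
    have h1 : b ⟨d, hd'⟩ = d := Module.Basis.extend_apply_self hli ⟨d, hd'⟩
    have h2 : h (b ⟨d, hd'⟩) = 1 := b.constr_basis ℝ _ _
    rwa [h1] at h2
  refine ⟨h, ?_⟩
  rintro α ⟨hα, s, c, hs, hc⟩
  have e : h α = ((∑ x ∈ s, c x : ℕ) : ℝ) := by
    rw [hc, map_sum]
    push_cast
    refine Finset.sum_congr rfl fun x hx => ?_
    rw [map_smul, hΔ x (hs hx)]; simp
  refine ⟨_, ?_, e⟩
  by_contra hlt
  have h0 : ∑ x ∈ s, c x = 0 := by omega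
  rw [Finset.sum_eq_zero_iff] at h0
  apply rs.nonzero
  have : α = 0 := by
    rw [hc]
    exact Finset.sum_eq_zero fun x hx => by rw [h0 x hx]; simp
  rwa [this] at hα

theorem aux_pos_or (rs : RootSystemData ℓ) {α : EucV ℓ} (h : α ∈ rs.Φ) :
    α ∈ rs.Pos ∨ -α ∈ rs.Pos := by
  rcases rs.pos_or_neg α h with h1 | h1
  · exact Or.inl ⟨h, h1⟩
  · exact Or.inr ⟨rs.neg_mem _ h, h1⟩

theorem aux_not_both (rs : RootSystemData ℓ) {α : EucV ℓ} (h : α ∈ rs.Pos)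
    (h' : -α ∈ rs.Pos) : False := by
  obtain ⟨f, hf⟩ := aux_height rs
  obtain ⟨n, hn, e⟩ := hf _ h
  obtain ⟨m, hm, e'⟩ := hf _ h'
  rw [map_neg, e] at e'
  have : ((n + m : ℕ) : ℝ) = 0 := by push_cast; linarith
  have := Nat.cast_eq_zero.1 this
  omega

theorem aux_ne_zero (rs : RootSystemData ℓ) {α : EucV ℓ} (h : α ∈ rs.Φ) : α ≠ 0 := by
  rintro rfl; exact rs.nonzero h

theorem aux_norm_pos (rs : RootSystemData ℓ) {α : EucV ℓ} (h : α ∈ rs.Φ) : 0 < ⟪α, α⟫_ℝ :=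
  real_inner_self_pos.2 (aux_ne_zero rs h)

theorem aux_indep (rs : RootSystemData ℓ) {α β : EucV ℓ} (hα : α ∈ rs.Φ) (hβ : β ∈ rs.Φ)
    (h1 : β ≠ α) (h2 : β ≠ -α) : ¬ ∃ t : ℝ, β = t • α := by
  rintro ⟨t, rfl⟩
  rcases rs.reduced α hα t hβ with rfl | rfl
  · simp at h1
  · simp at h2

theorem aux_indep_pos (rs : RootSystemData ℓ) {α β : EucV ℓ} (hα : α ∈ rs.Pos)
    (hβ : β ∈ rs.Pos) (h1 : β ≠ α) : ¬ ∃ t : ℝ, β = t • α :=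
  aux_indep rs hα.1 hβ.1 h1 (by rintro rfl; exact aux_not_both rs hα hβ)

theorem aux_cs {α β : EucV ℓ} (hα : 0 < ⟪α, α⟫_ℝ) (h : ¬ ∃ t : ℝ, β = t • α) :
    ⟪β, α⟫_ℝ * ⟪β, α⟫_ℝ < ⟪β, β⟫_ℝ * ⟪α, α⟫_ℝ := by
  have hne : β - (⟪β, α⟫_ℝ / ⟪α, α⟫_ℝ) • α ≠ 0 := fun h0 => h ⟨_, sub_eq_zero.1 h0⟩
  have := real_inner_self_pos.2 hne
  simp only [inner_sub_left, inner_sub_right, inner_smul_left, inner_smul_right,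
    real_inner_comm β α] at this
  simp only [conj_trivial] at this
  field_simp at this
  nlinarith

theorem aux_int {m n : ℤ} (h : 0 < m * n) (h' : m * n < 4) :
    -3 ≤ m ∧ m ≤ 3 ∧ -3 ≤ n ∧ n ≤ 3 := by
  rcases lt_trichotomy m 0 with h0 | h0 | h0
  · have : n < 0 := by nlinarith
    refine ⟨?_, ?_, ?_, ?_⟩ <;> nlinarith
  · subst h0; simp at h
  · have : 0 < n := by nlinarith
    refine ⟨?_, ?_, ?_, ?_⟩ <;> nlinarith

/-- Cartan integers of a pair of nonproportional roots. -/
theorem aux_cartan (rs : RootSystemData ℓ) {α β : EucV ℓ} (hα : α ∈ rs.Φ) (hβ : β ∈ rs.Φ)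
    (h : ¬ ∃ t : ℝ, β = t • α) :
    ∃ m n : ℤ, 2 * ⟪β, α⟫_ℝ = m * ⟪α, α⟫_ℝ ∧ 2 * ⟪β, α⟫_ℝ = n * ⟪β, β⟫_ℝ ∧ m * n < 4 ∧
      ((m = 0 ∧ n = 0) ∨ 0 < m * n) := by
  obtain ⟨m, hm⟩ := rs.cryst α hα β hβ
  obtain ⟨n, hn⟩ := rs.cryst β hβ α hα
  rw [real_inner_comm] at hn
  have pa := aux_norm_pos rs hα
  have pb := aux_norm_pos rs hβ
  have pab := mul_pos pb pa
  have cs := aux_cs pa h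
  have key : (m * n : ℝ) * (⟪β, β⟫_ℝ * ⟪α, α⟫_ℝ) = 4 * (⟪β, α⟫_ℝ * ⟪β, α⟫_ℝ) := by
    linear_combination (-(2 * ⟪β, α⟫_ℝ)) * hn - (n * ⟪β, β⟫_ℝ) * hm
  refine ⟨m, n, hm, hn, ?_, ?_⟩
  · have : (m * n : ℝ) < 4 := by
      by_contra hc
      push Not at hc
      nlinarith
    exact_mod_cast this
  · by_cases h0 : ⟪β, α⟫_ℝ = 0
    · left
      rw [h0] at hm hn
      constructor
      · have : (m : ℝ) = 0 := by
          rcases mul_eq_zero.1 (show (m : ℝ) * ⟪α, α⟫_ℝ = 0 by linarith) with h | h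
          · exact h
          · exact absurd h pa.ne'
        exact_mod_cast this
      · have : (n : ℝ) = 0 := by
          rcases mul_eq_zero.1 (show (n : ℝ) * ⟪β, β⟫_ℝ = 0 by linarith) with h | h
          · exact h
          · exact absurd h pb.ne'
        exact_mod_cast this
    · right
      have : (0 : ℝ) < m * n := by
        have := mul_self_pos.2 h0
        by_contra hc
        push Not at hc
        nlinarith
      exact_mod_cast this

theorem aux_refl (rs : RootSystemData ℓ) {α β : EucV ℓ} (hα : α ∈ rs.Φ) (hβ : β ∈ rs.Φ)
    {m : ℝ} (h : 2 * ⟪β, α⟫_ℝ = m * ⟪α, α⟫_ℝ) : β - m • α ∈ rs.Φ := by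
  have := rs.refl_mem α hα β hβ
  rwa [h, mul_div_cancel_right₀ _ (aux_norm_pos rs hα).ne'] at this

theorem aux_arith (p q m n : ℤ) (h1 : p * m < 4) (h1' : (p = 0 ∧ m = 0) ∨ 0 < p * m)
    (h2 : q * n < 4) (h2' : (q = 0 ∧ n = 0) ∨ 0 < q * n) (hx : p * n = 3 * q * m)
    (h3 : (p + 3 * q) * (m + n) < 4)
    (h4 : (2 * p + 3 * q) * (2 * m + n) < 4)
    (h5 : (3 * p + 3 * q) * (3 * m + n) < 12)
    (h6 : (3 * p + 6 * q) * (3 * m + 2 * n) < 12) : p = 0 ∧ q = 0 := by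
  have hp : -3 ≤ p ∧ p ≤ 3 := by
    rcases h1' with h | h
    · omega
    · have := aux_int h h1; omega
  have hq : -3 ≤ q ∧ q ≤ 3 := by
    rcases h2' with h | h
    · omega
    · have := aux_int h h2; omega
  obtain ⟨hp1, hp2⟩ := hp
  obtain ⟨hq1, hq2⟩ := hq
  interval_cases p <;> interval_cases q <;> omega

/-- Every root is orthogonal to a `G₂` pair or is one of its twelve roots. -/
theorem aux_G2_list (rs : RootSystemData ℓ) {a b : EucV ℓ} (ha : a ∈ rs.Φ) (hb : b ∈ rs.Φ)
    (h1 : 2 * ⟪b, a⟫_ℝ = -3 * ⟪a, a⟫_ℝ) (h2 : ⟪b, b⟫_ℝ = 3 * ⟪a, a⟫_ℝ) 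
    (M : (1 : ℝ) • a + (1 : ℝ) • b ∈ rs.Φ ∧ (2 : ℝ) • a + (1 : ℝ) • b ∈ rs.Φ ∧
      (3 : ℝ) • a + (1 : ℝ) • b ∈ rs.Φ ∧ (3 : ℝ) • a + (2 : ℝ) • b ∈ rs.Φ)
    {δ : EucV ℓ} (hδ : δ ∈ rs.Φ) (hno : ⟪δ, a⟫_ℝ ≠ 0 ∨ ⟪δ, b⟫_ℝ ≠ 0) :
    ∃ x y : ℝ, ((x = 1 ∧ y = 0) ∨ (x = 0 ∧ y = 1) ∨ (x = 1 ∧ y = 1) ∨ (x = 2 ∧ y = 1) ∨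
      (x = 3 ∧ y = 1) ∨ (x = 3 ∧ y = 2)) ∧ (δ = x • a + y • b ∨ δ = -(x • a + y • b)) := by
  by_contra hcon
  push Not at hcon
  have pa := aux_norm_pos rs ha
  have pd := aux_norm_pos rs hδ
  have na : ¬ ∃ t : ℝ, δ = t • a := by
    have := hcon 1 0 (by norm_num)
    simp only [one_smul, zero_smul, add_zero] at this
    exact aux_indep rs ha hδ this.1 this.2
  have nb : ¬ ∃ t : ℝ, δ = t • b := by
    have := hcon 0 1 (by norm_num)
    simp only [one_smul, zero_smul, zero_add] at this
    exact aux_indep rs hb hδ this.1 this.2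
  obtain ⟨p, m, e1, e2, l1, l2⟩ := aux_cartan rs ha hδ na
  obtain ⟨q, n, e3, e4, l3, l4⟩ := aux_cartan rs hb hδ nb
  rw [h2] at e3
  have hx : p * n = 3 * q * m := by
    have : (p * n : ℝ) = 3 * q * m := by
      have hne : ⟪a, a⟫_ℝ * ⟪δ, δ⟫_ℝ ≠ 0 := (mul_pos pa pd).ne'
      apply mul_right_cancel₀ hne
      linear_combination (-(n * ⟪δ, δ⟫_ℝ)) * e1 + (n * ⟪δ, δ⟫_ℝ) * e2 + (m * ⟪δ, δ⟫_ℝ) * e3 - (m * ⟪δ, δ⟫_ℝ) * e4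
    exact_mod_cast this
  have main : ∀ x y c : ℤ, (x : ℝ) • a + (y : ℝ) • b ∈ rs.Φ → 
      x * x - 3 * x * y + 3 * y * y = c →
      δ ≠ (x : ℝ) • a + (y : ℝ) • b → δ ≠ -((x : ℝ) • a + (y : ℝ) • b) →
      (x * p + 3 * y * q) * (x * m + y * n) < 4 * c := by
    intro x y c hm hc n1 n2
    have cs := aux_cs (aux_norm_pos rs hm) (aux_indep rs hm hδ n1 n2)
    simp only [inner_add_left, inner_add_right, inner_smul_left, inner_smul_right,
      conj_trivial, real_inner_comm b a] at cs
    have hc' : (x * x - 3 * x * y + 3 * y * y : ℝ) = c := by exact_mod_cast hc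
    have hn : (x * (x * ⟪a, a⟫_ℝ + y * ⟪b, a⟫_ℝ) + y * (x * ⟪b, a⟫_ℝ + y * ⟪b, b⟫_ℝ)) 
        = c * ⟪a, a⟫_ℝ := by
      rw [h2]; linear_combination (x * y) * h1 + ⟪a, a⟫_ℝ * hc'
    have : ((x * p + 3 * y * q) * (x * m + y * n) : ℝ) < 4 * c := by
      have key : ((x * p + 3 * y * q) * (x * m + y * n) : ℝ) * (⟪a, a⟫_ℝ * ⟪δ, δ⟫_ℝ) = 
        4 * ((x * ⟪δ, a⟫_ℝ + y * ⟪δ, b⟫_ℝ) * (x * ⟪δ, a⟫_ℝ + y * ⟪δ, b⟫_ℝ)) := by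
        have k1 : 2 * (x * ⟪δ, a⟫_ℝ + y * ⟪δ, b⟫_ℝ) = (x * p + 3 * y * q) * ⟪a, a⟫_ℝ := by
          linear_combination x * e1 + y * e3
        have k2 : 2 * (x * ⟪δ, a⟫_ℝ + y * ⟪δ, b⟫_ℝ) = (x * m + y * n) * ⟪δ, δ⟫_ℝ := by
          linear_combination x * e2 + y * e4
        linear_combination (-(2 * (x * ⟪δ, a⟫_ℝ + y * ⟪δ, b⟫_ℝ))) * k2 - ((x * m + y * n) * ⟪δ, δ⟫_ℝ) * k1
      refine lt_of_mul_lt_mul_right ?_ (mul_pos pa pd).le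
      rw [key]
      have : 4 * (c : ℝ) * (⟪a, a⟫_ℝ * ⟪δ, δ⟫_ℝ) = 4 * (⟪δ, δ⟫_ℝ * (c * ⟪a, a⟫_ℝ)) := by ring
      rw [this, ← hn]
      linarith
    exact_mod_cast this
  obtain ⟨M1, M2, M3, M4⟩ := M
  have c1 := hcon 1 1 (by norm_num)
  have c2 := hcon 2 1 (by norm_num)
  have c3 := hcon 3 1 (by norm_num)
  have c4 := hcon 3 2 (by norm_num)
  have i1 := main 1 1 1 (by exact_mod_cast M1) (by norm_num) (by exact_mod_cast c1.1) (by exact_mod_cast c1.2)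
  have i2 := main 2 1 1 (by exact_mod_cast M2) (by norm_num) (by exact_mod_cast c2.1) (by exact_mod_cast c2.2)
  have i3 := main 3 1 3 (by exact_mod_cast M3) (by norm_num) (by exact_mod_cast c3.1) (by exact_mod_cast c3.2)
  have i4 := main 3 2 3 (by exact_mod_cast M4) (by norm_num) (by exact_mod_cast c4.1) (by exact_mod_cast c4.2)
  obtain ⟨rfl, rfl⟩ := aux_arith p q m n l1 l2 l3 l4 hx (by linarith) (by linarith) (by linarith) (by linarith)
  simp at e1 e3
  rcases hno with h | h
  · exact h e1
  · exact h e3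

theorem aux_no_G2_core (rs : RootSystemData ℓ) (hirr : IrredSet rs.Φ)
    (hG2 : ¬ (ℓ = 2 ∧ rs.Pos.ncard = 6)) {a b : EucV ℓ} (ha : a ∈ rs.Φ) (hb : b ∈ rs.Φ)
    (h1 : 2 * ⟪b, a⟫_ℝ = -3 * ⟪a, a⟫_ℝ) (h2 : ⟪b, b⟫_ℝ = 3 * ⟪a, a⟫_ℝ) : False := by
  have pa := aux_norm_pos rs ha
  have h1' : 2 * ⟪a, b⟫_ℝ = -1 * ⟪b, b⟫_ℝ := by rw [real_inner_comm]; linarith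
  have m3 : (3 : ℝ) • a + (1 : ℝ) • b ∈ rs.Φ := by
    have := aux_refl rs ha hb h1
    convert this using 1; module
  have m1 : (1 : ℝ) • a + (1 : ℝ) • b ∈ rs.Φ := by
    have := aux_refl rs hb ha h1'
    convert this using 1; module
  have m2 : (2 : ℝ) • a + (1 : ℝ) • b ∈ rs.Φ := by
    have := aux_refl rs ha m1 (m := -1) (by
      simp only [inner_add_left, inner_smul_left, conj_trivial]; linarith)
    convert this using 1; module
  have m4 : (3 : ℝ) • a + (2 : ℝ) • b ∈ rs.Φ := by
    have := aux_refl rs hb m3 (m := -1) (by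
      simp only [inner_add_left, inner_smul_left, conj_trivial]; linarith)
    convert this using 1; module
  have hli : ∀ x y : ℝ, x • a + y • b = 0 → x = 0 ∧ y = 0 := by
    intro x y h
    have i1 : ⟪x • a + y • b, a⟫_ℝ = 0 := by rw [h]; simp
    have i2 : ⟪x • a + y • b, b⟫_ℝ = 0 := by rw [h]; simp
    simp only [inner_add_left, inner_smul_left, conj_trivial] at i1 i2
    have e1 : (2 * x - 3 * y) * ⟪a, a⟫_ℝ = 0 := by linear_combination 2 * i1 - y * h1
    have e2 : (2 * y - x) * ⟪a, a⟫_ℝ = 0 := by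
      linear_combination (2/3) * i2 - (x/3) * h1' - (2*y/3 - x/3) * h2
    have e1' := (mul_eq_zero.1 e1).resolve_right pa.ne'
    have e2' := (mul_eq_zero.1 e2).resolve_right pa.ne'
    constructor <;> linarith
  have hlist := fun δ hδ => @aux_G2_list ℓ rs a b ha hb h1 h2 ⟨m1, m2, m3, m4⟩ δ hδ
  have hall : ∀ δ ∈ rs.Φ, ⟪δ, a⟫_ℝ ≠ 0 ∨ ⟪δ, b⟫_ℝ ≠ 0 := by
    by_contra hc
    push Not at hc
    obtain ⟨δ₀, hδ₀, hd⟩ := hc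
    apply hirr
    refine ⟨{δ ∈ rs.Φ | ⟪δ, a⟫_ℝ ≠ 0 ∨ ⟪δ, b⟫_ℝ ≠ 0}, {δ ∈ rs.Φ | ⟪δ, a⟫_ℝ = 0 ∧ ⟪δ, b⟫_ℝ = 0},
      ⟨a, ha, Or.inl pa.ne'⟩, ⟨δ₀, hδ₀, hd⟩, ?_, ?_⟩
    · ext δ
      simp only [Set.mem_union, Set.mem_ofPred_eq]
      tauto
    · rintro δ ⟨hδ, hδ'⟩ ε ⟨hε, he1, he2⟩
      rw [real_inner_comm] at he1 he2
      obtain ⟨x, y, -, rfl | rfl⟩ := hlist δ hδ hδ'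
      · simp [inner_add_left, inner_smul_left, he1, he2]
      · simp [inner_add_left, inner_smul_left, he1, he2]
  apply hG2
  constructor
  · have hind : LinearIndependent ℝ ![a, b] := by
      rw [LinearIndependent.pair_iff]; exact hli
    have hsp : Submodule.span ℝ (Set.range ![a, b]) = ⊤ := by
      rw [eq_top_iff, ← rs.spanning, Submodule.span_le]
      intro δ hδ
      have haa : a ∈ Submodule.span ℝ (Set.range ![a, b]) := Submodule.subset_span ⟨0, rfl⟩
      have hbb : b ∈ Submodule.span ℝ (Set.range ![a, b]) := Submodule.subset_span ⟨1, rfl⟩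
      obtain ⟨x, y, -, rfl | rfl⟩ := hlist δ hδ (hall δ hδ)
      · exact Submodule.add_mem _ (Submodule.smul_mem _ _ haa) (Submodule.smul_mem _ _ hbb)
      · exact Submodule.neg_mem _ 
          (Submodule.add_mem _ (Submodule.smul_mem _ _ haa) (Submodule.smul_mem _ _ hbb))
    have := finrank_span_eq_card hind
    rw [hsp, finrank_top, finrank_euclideanSpace_fin] at this
    simpa using this
  · classical
    let cx : Fin 6 → ℝ := ![1, 0, 1, 2, 3, 3]
    let cy : Fin 6 → ℝ := ![0, 1, 1, 1, 1, 2]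
    let g : Fin 6 → EucV ℓ := fun i => cx i • a + cy i • b
    have hg : ∀ i, g i ∈ rs.Φ := by
      intro i
      fin_cases i
      · simpa [g, cx, cy] using ha
      · simpa [g, cx, cy] using hb
      · exact m1
      · exact m2
      · exact m3
      · exact m4
    let f : Fin 6 → EucV ℓ := fun i => if g i ∈ rs.Pos then g i else -g i
    have hf : ∀ i, f i = g i ∨ f i = - g i := by
      intro i; simp only [f]; split_ifs <;> simp
    have hfpos : ∀ i, f i ∈ rs.Pos := by
      intro i
      by_cases h : g i ∈ rs.Pos
      · simp only [f, if_pos h]; exact h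
      · simp only [f, if_neg h]; exact (aux_pos_or rs (hg i)).resolve_left h
    have hcoord : ∀ i j (t : ℝ), g i = t • g j → cx i = t * cx j ∧ cy i = t * cy j := by
      intro i j t h
      have : (cx i - t * cx j) • a + (cy i - t * cy j) • b = 0 := by
        have h' := sub_eq_zero.2 h
        rw [← h']; simp only [g]; module
      have := hli _ _ this
      constructor <;> linarith
    have hinj : Function.Injective f := by
      intro i j h
      have : g i = (1 : ℝ) • g j ∨ g i = (-1 : ℝ) • g j := by
        rcases hf i with hi | hi <;> rcases hf j with hj | hj <;> rw [hi, hj] at h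
        · left; simpa using h
        · right; simpa using h
        · right; rw [neg_one_smul, ← h, neg_neg]
        · left; simpa using h
      rcases this with h | h
      · have := hcoord _ _ _ h
        fin_cases i <;> fin_cases j <;> first | rfl | (exfalso; simp [cx, cy] at this; try linarith)
      · have := hcoord _ _ _ h
        fin_cases i <;> fin_cases j <;> first | rfl | (exfalso; simp [cx, cy] at this; try linarith)
    have hrange : rs.Pos = Set.range f := by
      ext δ
      constructor
      · intro hδ
        obtain ⟨x, y, hxy, hd⟩ := hlist δ hδ.1 (hall δ hδ.1)
        have : ∃ i, x = cx i ∧ y = cy i := by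
          rcases hxy with ⟨rfl, rfl⟩ | ⟨rfl, rfl⟩ | ⟨rfl, rfl⟩ | ⟨rfl, rfl⟩ | ⟨rfl, rfl⟩ | ⟨rfl, rfl⟩
          · exact ⟨0, rfl, rfl⟩
          · exact ⟨1, rfl, rfl⟩
          · exact ⟨2, rfl, rfl⟩
          · exact ⟨3, rfl, rfl⟩
          · exact ⟨4, rfl, rfl⟩
          · exact ⟨5, rfl, rfl⟩
        obtain ⟨i, rfl, rfl⟩ := this
        refine ⟨i, ?_⟩
        change δ = g i ∨ δ = - g i at hd
        have hfi := hfpos i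
        rcases hf i with h | h <;> rcases hd with h' | h'
        · rw [h, h']
        · exfalso; rw [h] at hfi; rw [h'] at hδ; exact aux_not_both rs hfi hδ
        · exfalso; rw [h] at hfi; rw [h'] at hδ; exact aux_not_both rs hδ hfi
        · rw [h, h']
      · rintro ⟨i, rfl⟩; exact hfpos i
    rw [hrange, ← Set.image_univ, Set.ncard_image_of_injective _ hinj]
    simp [Set.ncard_univ]

theorem aux_no_G2 (rs : RootSystemData ℓ) (hirr : IrredSet rs.Φ)
    (hG2 : ¬ (ℓ = 2 ∧ rs.Pos.ncard = 6)) {a b : EucV ℓ} (ha : a ∈ rs.Φ) (hb : b ∈ rs.Φ)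
    {m n : ℤ} (h1 : 2 * ⟪b, a⟫_ℝ = m * ⟪a, a⟫_ℝ) (h2 : 2 * ⟪b, a⟫_ℝ = n * ⟪b, b⟫_ℝ)
    (h : m * n = 3) : False := by
  have hm : 0 < m * n := by omega
  obtain ⟨b1, b2, b3, b4⟩ := aux_int hm (by omega)
  have hc : (m = 3 ∧ n = 1) ∨ (m = 1 ∧ n = 3) ∨ (m = -3 ∧ n = -1) ∨ (m = -1 ∧ n = -3) := by
    interval_cases m <;> omega
  rcases hc with ⟨rfl, rfl⟩ | ⟨rfl, rfl⟩ | ⟨rfl, rfl⟩ | ⟨rfl, rfl⟩ <;> push_cast at h1 h2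
  · refine aux_no_G2_core rs hirr hG2 ha (rs.neg_mem b hb) ?_ ?_ <;>
      simp only [inner_neg_left, inner_neg_right] <;> linarith
  · refine aux_no_G2_core rs hirr hG2 hb (rs.neg_mem a ha) ?_ ?_ <;>
      simp only [inner_neg_left, inner_neg_right, real_inner_comm b a] <;> linarith
  · exact aux_no_G2_core rs hirr hG2 ha hb (by linarith) (by linarith)
  · exact aux_no_G2_core rs hirr hG2 hb ha (by rw [real_inner_comm]; linarith) (by linarith)

theorem aux_indep_pair {α β : EucV ℓ} (h0 : α ≠ 0) (h : ¬ ∃ t : ℝ, β = t • α) :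
    LinearIndependent ℝ ![α, β] := by
  rw [LinearIndependent.pair_iff' h0]
  intro t ht
  exact h ⟨t, ht.symm⟩

/-- Elements orthogonal to the flat lie in the plane. -/
theorem aux_perp {α β γ : EucV ℓ}
    (h : ∀ x : EucV ℓ, ⟪α, x⟫_ℝ = 0 ∧ ⟪β, x⟫_ℝ = 0 → ⟪γ, x⟫_ℝ = 0) :
    γ ∈ Submodule.span ℝ {α, β} := by
  rw [← Submodule.orthogonal_orthogonal (Submodule.span ℝ {α, β}), Submodule.mem_orthogonal]
  intro x hx
  rw [Submodule.mem_orthogonal] at hx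
  rw [real_inner_comm]
  exact h x ⟨hx α (Submodule.subset_span (by simp)), hx β (Submodule.subset_span (by simp))⟩

theorem aux_loc_comb (rs : RootSystemData ℓ) {X : Set (EucV ℓ)} (hX : rs.IsCodim2Flat X)
    {a b γ : EucV ℓ} (ha : a ∈ rs.locΦ X) (hb : b ∈ rs.locΦ X) (hab : ¬ ∃ t : ℝ, b = t • a)
    (hγ : γ ∈ rs.locΦ X) : ∃ x y : ℝ, γ = x • a + y • b := by
  obtain ⟨α, hα, β, hβ, hn, rfl⟩ := hX
  have key : ∀ δ ∈ rs.locΦ {x : EucV ℓ | ⟪α, x⟫_ℝ = 0 ∧ ⟪β, x⟫_ℝ = 0},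
      δ ∈ Submodule.span ℝ {α, β} := fun δ hδ => aux_perp fun x hx => hδ.2 x hx
  have le : Submodule.span ℝ {a, b} ≤ Submodule.span ℝ {α, β} := by
    rw [Submodule.span_le]
    rintro x (rfl | rfl)
    · exact key _ ha
    · exact key _ hb
  have f1 := finrank_span_eq_card (aux_indep_pair (aux_ne_zero rs ha.1) hab)
  have f2 := finrank_span_eq_card (aux_indep_pair (aux_ne_zero rs hα.1) hn)
  have eq := Submodule.eq_of_le_of_finrank_eq le (by
    have r : ∀ u v : EucV ℓ, Set.range ![u, v] = {u, v} := fun u v => by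
      simp [Matrix.range_cons, Matrix.range_empty, Set.pair_comm]
    rw [r] at f1 f2
    exact f1.trans f2.symm)
  have := key γ hγ
  rw [← eq, Submodule.mem_span_pair] at this
  obtain ⟨x, y, h⟩ := this
  exact ⟨x, y, h.symm⟩

theorem aux_loc_add (rs : RootSystemData ℓ) {X : Set (EucV ℓ)} {a b : EucV ℓ} (x y : ℝ)
    (ha : a ∈ rs.locΦ X) (hb : b ∈ rs.locΦ X) (h : x • a + y • b ∈ rs.Φ) :
    x • a + y • b ∈ rs.locΦ X := by
  refine ⟨h, fun z hz => ?_⟩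
  simp [inner_add_left, inner_smul_left, ha.2 z hz, hb.2 z hz]

theorem aux_closure (rs : RootSystemData ℓ) (X : Set (EucV ℓ)) :
    ∀ γ ∈ rs.locPos X, γ ∈ AddSubmonoid.closure (rs.locΔ X) := by
  obtain ⟨h, hh⟩ := aux_height rs
  have : ∀ n : ℕ, ∀ γ ∈ rs.locPos X, h γ ≤ n → γ ∈ AddSubmonoid.closure (rs.locΔ X) := by
    intro n
    induction n with
    | zero =>
      intro γ hγ hn
      obtain ⟨k, hk, e⟩ := hh γ hγ.1
      rw [e] at hn
      have := Nat.cast_le.1 hn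
      omega
    | succ n ih =>
      intro γ hγ hn
      by_cases hs : ∃ β ∈ rs.locPos X, ∃ γ' ∈ rs.locPos X, γ = β + γ'
      · obtain ⟨β, hβ, γ', hγ', rfl⟩ := hs
        obtain ⟨k, hk, e⟩ := hh β hβ.1
        obtain ⟨k', hk', e'⟩ := hh γ' hγ'.1
        rw [map_add] at hn
        have c1 : (1 : ℝ) ≤ k := by exact_mod_cast hk
        have c2 : (1 : ℝ) ≤ k' := by exact_mod_cast hk'
        push_cast at hn
        exact AddSubmonoid.add_mem _ (ih β hβ (by linarith)) (ih γ' hγ' (by linarith))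
      · exact AddSubmonoid.subset_closure ⟨hγ, hs⟩
  intro γ hγ
  obtain ⟨k, hk, e⟩ := hh γ hγ.1
  exact this k γ hγ e.le

theorem aux_obtuse (rs : RootSystemData ℓ) {X : Set (EucV ℓ)} {a b : EucV ℓ}
    (ha : a ∈ rs.locΔ X) (hb : b ∈ rs.locΔ X) (hne : b ≠ a) : ⟪b, a⟫_ℝ ≤ 0 := by
  by_contra hc
  push Not at hc
  have hsub : ∀ a b : EucV ℓ, a ∈ rs.locΔ X → b ∈ rs.locΔ X → b - a ∈ rs.Φ → False := by
    intro a b ha hb h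
    have hl : b - a ∈ rs.locΦ X := by
      have := aux_loc_add rs (1 : ℝ) (-1) hb.1.2 ha.1.2 (by convert h using 1; module)
      convert this using 1; module
    rcases aux_pos_or rs h with h' | h'
    · exact hb.2 ⟨a, ha.1, b - a, ⟨h', hl⟩, by module⟩
    · refine ha.2 ⟨b, hb.1, -(b - a), ⟨h', rs.neg_mem _ h, fun z hz => ?_⟩, by module⟩
      rw [inner_neg_left, hl.2 z hz, neg_zero]
  obtain ⟨m, n, e1, e2, l1, l2⟩ := aux_cartan rs ha.1.1.1 hb.1.1.1 (aux_indep_pos rs ha.1.1 hb.1.1 hne)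
  have pa := aux_norm_pos rs ha.1.1.1
  have hm : 0 < m := by
    have : (0 : ℝ) < m := by
      by_contra h; push Not at h; nlinarith
    exact_mod_cast this
  have hmn : 0 < m * n := l2.resolve_left (by omega)
  have hn : 0 < n := by nlinarith
  have : m = 1 ∨ n = 1 := by
    by_contra h; push Not at h
    have : 2 ≤ m := by omega
    have : 2 ≤ n := by omega
    nlinarith
  rcases this with rfl | rfl
  · apply hsub a b ha hb
    have := aux_refl rs ha.1.1.1 hb.1.1.1 e1
    simpa using this
  · apply hsub b a hb ha
    rw [real_inner_comm] at e2
    have := aux_refl rs hb.1.1.1 ha.1.1.1 e2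
    simpa using this

/-- Structure of the simple system of an irreducible rank two localization. -/
theorem aux_structure (rs : RootSystemData ℓ) {X : Set (EucV ℓ)} (hX : rs.IsCodim2Flat X)
    (hI : IrredSet (rs.locΦ X)) :
    ∃ a b : EucV ℓ, a ∈ rs.locΔ X ∧ b ∈ rs.locΔ X ∧ b ≠ a ∧ ⟪b, a⟫_ℝ < 0 ∧
      rs.locΔ X = {a, b} ∧ ∀ γ ∈ rs.locPos X, ∃ x y : ℕ, γ = (x : ℝ) • a + (y : ℝ) • b := by
  obtain ⟨h, hh⟩ := aux_height rs
  have hpos : ∀ γ ∈ rs.Pos, 0 < h γ := by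
    intro γ hγ
    obtain ⟨n, hn, e⟩ := hh γ hγ
    rw [e]; exact_mod_cast hn
  have ex : ∃ a ∈ rs.locΔ X, ∃ b ∈ rs.locΔ X, b ≠ a := by
    by_contra hc
    push Not at hc
    obtain ⟨α, hα, β, hβ, hn, hXe⟩ := hX
    have hα' : α ∈ rs.locPos X := ⟨hα, hα.1, fun x hx => by rw [hXe] at hx; exact hx.1⟩
    have hβ' : β ∈ rs.locPos X := ⟨hβ, hβ.1, fun x hx => by rw [hXe] at hx; exact hx.2⟩
    have c1 := aux_closure rs X α hα'
    have c2 := aux_closure rs X β hβ'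
    rcases (rs.locΔ X).eq_empty_or_nonempty with he | ⟨a, ha⟩
    · rw [he, AddSubmonoid.closure_empty, AddSubmonoid.mem_bot] at c1
      exact aux_ne_zero rs hα.1 c1
    · have he : rs.locΔ X = {a} := by
        ext x
        exact ⟨fun hx => hc a ha x hx, fun hx => by rw [Set.mem_singleton_iff] at hx; rwa [hx]⟩
      rw [he, AddSubmonoid.mem_closure_singleton] at c1 c2
      obtain ⟨k, rfl⟩ := c1
      obtain ⟨l, rfl⟩ := c2
      have hk : (k : ℝ) ≠ 0 := by
        intro h0
        have : k = 0 := by exact_mod_cast h0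
        subst this
        exact aux_ne_zero rs hα.1 (by simp)
      apply hn
      refine ⟨(l : ℝ) / k, ?_⟩
      rw [← Nat.cast_smul_eq_nsmul ℝ, ← Nat.cast_smul_eq_nsmul ℝ, smul_smul,
        div_mul_cancel₀ _ hk]
  obtain ⟨a, ha, b, hb, hne⟩ := ex
  have hind := aux_indep_pos rs ha.1.1 hb.1.1 hne
  have pa := aux_norm_pos rs ha.1.1.1
  have pb := aux_norm_pos rs hb.1.1.1
  have hab := aux_obtuse rs ha hb hne
  have hΔ : rs.locΔ X = {a, b} := by
    ext c
    constructor
    · intro hc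
      by_contra hcn
      simp only [Set.mem_insert_iff, Set.mem_singleton_iff, not_or] at hcn
      have o1 := aux_obtuse rs ha hc hcn.1
      have o2 := aux_obtuse rs hb hc hcn.2
      have pc := aux_norm_pos rs hc.1.1.1
      have hc0 := hpos c hc.1.1
      have ha0 := hpos a ha.1.1
      have hb0 := hpos b hb.1.1
      obtain ⟨s, t, e⟩ := aux_loc_comb rs hX ha.1.2 hb.1.2 hind hc.1.2
      have n0 : ⟪c, c⟫_ℝ = s * ⟪c, a⟫_ℝ + t * ⟪c, b⟫_ℝ := by
        have : ⟪c, c⟫_ℝ = ⟪c, s • a + t • b⟫_ℝ := by rw [← e]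
        rw [this, inner_add_right, inner_smul_right, inner_smul_right]
      have n1 : ⟪c, a⟫_ℝ = s * ⟪a, a⟫_ℝ + t * ⟪b, a⟫_ℝ := by
        rw [e]; simp [inner_add_left, inner_smul_left]
      have n2 : ⟪c, b⟫_ℝ = s * ⟪b, a⟫_ℝ + t * ⟪b, b⟫_ℝ := by
        rw [e]; simp [inner_add_left, inner_smul_left, real_inner_comm]
      rw [e, map_add, map_smul, map_smul, smul_eq_mul, smul_eq_mul] at hc0
      rcases lt_or_ge s 0 with hs | hs
      · have ht : 0 < t := by by_contra ht; push Not at ht; nlinarith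
        nlinarith [mul_pos ht pb, mul_nonneg_of_nonpos_of_nonpos hs.le hab]
      · rcases lt_or_ge t 0 with ht | ht
        · have hs' : 0 < s := by by_contra ht; push Not at ht; nlinarith
          nlinarith [mul_pos hs' pa, mul_nonneg_of_nonpos_of_nonpos ht.le hab]
        · nlinarith [mul_nonneg hs (neg_nonneg.2 o1), mul_nonneg ht (neg_nonneg.2 o2)]
    · rintro (rfl | rfl)
      · exact ha
      · exact hb
  have hcomb : ∀ γ ∈ rs.locPos X, ∃ x y : ℕ, γ = (x : ℝ) • a + (y : ℝ) • b := by
    intro γ hγ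
    have := aux_closure rs X γ hγ
    rw [hΔ, AddSubmonoid.mem_closure_pair] at this
    obtain ⟨x, y, e⟩ := this
    exact ⟨x, y, by rw [← e, Nat.cast_smul_eq_nsmul, Nat.cast_smul_eq_nsmul]⟩
  refine ⟨a, b, ha, hb, hne, lt_of_le_of_ne hab ?_, hΔ, hcomb⟩
  intro h0
  apply hI
  have hli := LinearIndependent.pair_iff.1 (aux_indep_pair (aux_ne_zero rs ha.1.1.1) hind)
  have hor : ∀ γ ∈ rs.locPos X, (∃ t : ℝ, γ = t • a) ∨ ∃ t : ℝ, γ = t • b := by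
    intro γ hγ
    obtain ⟨x, y, e⟩ := hcomb γ hγ
    by_cases hx : x = 0
    · right; exact ⟨y, by rw [e, hx]; simp⟩
    by_cases hy : y = 0
    · left; exact ⟨x, by rw [e, hy]; simp⟩
    exfalso
    have hr : (-x : ℝ) • a + (y : ℝ) • b ∈ rs.Φ := by
      have := aux_refl rs ha.1.1.1 hγ.1.1 (m := 2 * x) (by
        rw [e, inner_add_left, inner_smul_left, inner_smul_left, h0]; simp; ring)
      convert this using 1
      rw [e]; module
    have hrl := aux_loc_add rs _ _ ha.1.2 hb.1.2 hr
    have x0 : (0 : ℝ) < x := by exact_mod_cast Nat.pos_of_ne_zero hx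
    have y0 : (0 : ℝ) < y := by exact_mod_cast Nat.pos_of_ne_zero hy
    rcases aux_pos_or rs hr with hp | hp
    · obtain ⟨u, v, e'⟩ := hcomb _ ⟨hp, hrl⟩
      have := (hli (-x - u) (y - v) (by rw [← sub_eq_zero] at e'; rw [← e']; module)).1
      have : (0 : ℝ) ≤ u := Nat.cast_nonneg u
      linarith
    · obtain ⟨u, v, e'⟩ := hcomb _ ⟨hp, rs.neg_mem _ hr, fun z hz => by
        rw [inner_neg_left, hrl.2 z hz, neg_zero]⟩
      have := (hli (x - u) (-y - v) (by rw [← sub_eq_zero] at e'; rw [← e']; module)).2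
      have : (0 : ℝ) ≤ v := Nat.cast_nonneg v
      linarith
  refine ⟨{γ ∈ rs.locΦ X | ∃ t : ℝ, γ = t • a}, {γ ∈ rs.locΦ X | ∃ t : ℝ, γ = t • b},
    ⟨a, ha.1.2, 1, by simp⟩, ⟨b, hb.1.2, 1, by simp⟩, ?_, ?_⟩
  · ext γ
    constructor
    · intro hγ
      have : (∃ t : ℝ, γ = t • a) ∨ ∃ t : ℝ, γ = t • b := by
        rcases aux_pos_or rs hγ.1 with hp | hp
        · exact hor γ ⟨hp, hγ⟩
        · rcases hor (-γ) ⟨hp, rs.neg_mem _ hγ.1, fun z hz => by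
            rw [inner_neg_left, hγ.2 z hz, neg_zero]⟩ with ⟨t, ht⟩ | ⟨t, ht⟩
          · left; exact ⟨-t, by rw [neg_smul, ← ht, neg_neg]⟩
          · right; exact ⟨-t, by rw [neg_smul, ← ht, neg_neg]⟩
      rcases this with h | h
      · exact Or.inl ⟨hγ, h⟩
      · exact Or.inr ⟨hγ, h⟩
    · rintro (h | h) <;> exact h.1
  · rintro _ ⟨-, s, rfl⟩ _ ⟨-, t, rfl⟩
    rw [inner_smul_left, inner_smul_right, real_inner_comm, h0]; simp

theorem aux_smul_one (rs : RootSystemData ℓ) {b : EucV ℓ} {y : ℕ} (hb : b ∈ rs.Φ)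
    (h : (y : ℝ) • b ∈ rs.Φ) : (y : ℝ) = 1 := by
  rcases rs.reduced b hb _ h with h | h
  · exact h
  · have : (0 : ℝ) ≤ y := Nat.cast_nonneg y
    linarith

/-- Without `G₂`, nonsimple positive roots are dominant. -/
theorem aux_dominant (rs : RootSystemData ℓ) (hirr : IrredSet rs.Φ)
    (hG2 : ¬ (ℓ = 2 ∧ rs.Pos.ncard = 6)) {a b γ : EucV ℓ} (ha : a ∈ rs.Φ) (hb : b ∈ rs.Φ)
    (hγ : γ ∈ rs.Φ) (hab : ¬ ∃ t : ℝ, b = t • a) (hneg : ⟪b, a⟫_ℝ < 0) {x y : ℕ} (hx : x ≠ 0)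
    (hy : y ≠ 0) (e : γ = (x : ℝ) • a + (y : ℝ) • b) : 0 ≤ ⟪γ, a⟫_ℝ := by
  by_contra hc
  push Not at hc
  have pa := aux_norm_pos rs ha
  have pb := aux_norm_pos rs hb
  have x0 : (x : ℝ) ≠ 0 := by exact_mod_cast hx
  have hgb : ¬ ∃ t : ℝ, γ = t • b := by
    rintro ⟨t, ht⟩
    have hli := LinearIndependent.pair_iff.1 (aux_indep_pair (aux_ne_zero rs ha) hab)
    refine x0 (hli x (y - t) ?_).1
    rw [e, ← sub_eq_zero] at ht
    rw [← ht]; module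
  obtain ⟨m, n, e1, e2, l1, l2⟩ := aux_cartan rs ha hb hab
  obtain ⟨q, q', f1, f2, k1, k2⟩ := aux_cartan rs hb hγ hgb
  have n1 : ⟪γ, a⟫_ℝ = x * ⟪a, a⟫_ℝ + y * ⟪b, a⟫_ℝ := by
    rw [e]; simp [inner_add_left, inner_smul_left]
  have n2 : ⟪γ, b⟫_ℝ = x * ⟪b, a⟫_ℝ + y * ⟪b, b⟫_ℝ := by
    rw [e]; simp [inner_add_left, inner_smul_left, real_inner_comm]
  have hm : m < 0 := by
    have : (m : ℝ) < 0 := by by_contra h; push Not at h; nlinarith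
    exact_mod_cast this
  have hmn : 0 < m * n := l2.resolve_left (by omega)
  have hmn3 : m * n ≠ 3 := fun h => aux_no_G2 rs hirr hG2 ha hb e1 e2 h
  have hqq3 : q * q' ≠ 3 := fun h => aux_no_G2 rs hirr hG2 hb hγ f1 f2 h
  have hp : 2 * (x : ℤ) + m * y < 0 := by
    have : (2 * x + m * y : ℝ) < 0 := by
      have : (2 * x + m * y : ℝ) * ⟪a, a⟫_ℝ < 0 := by
        have : (2 * x + m * y : ℝ) * ⟪a, a⟫_ℝ = 2 * ⟪γ, a⟫_ℝ := by
          rw [n1]; linear_combination (-y : ℝ) * e1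
        linarith
      by_contra h; push Not at h; nlinarith
    exact_mod_cast this
  have hq : q = 2 * y + n * x := by
    have : (q : ℝ) = 2 * y + n * x := by
      apply mul_right_cancel₀ pb.ne'
      rw [← f1, n2]; linear_combination (x : ℝ) * e2
    exact_mod_cast this
  obtain ⟨b1, b2, b3, b4⟩ := aux_int hmn l1
  have hqb : q ≤ 2 := by
    rcases k2 with h | h
    · omega
    · by_contra hh
      have h3 : 3 ≤ q := by omega
      have : 0 < q' := by nlinarith
      apply hqq3
      nlinarith
  interval_cases m <;> interval_cases n <;> omega

/-- Let `Φ` be an irreducible crystallographic root system that is not of type `G₂`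
(equivalently, not of rank `2` with `|Φ⁺| = 6`). A subset `Σ ⊆ Φ⁺` is negatively
coclosed if and only if `Σ` is 2-locally simple. -/
theorem negatively_coclosed_iff_two_locally_simple
    {ℓ : ℕ} (rs : RootSystemData ℓ) (hirr : IrredSet rs.Φ)
    (hG2 : ¬ (ℓ = 2 ∧ rs.Pos.ncard = 6))
    (S : Set (EucV ℓ)) (hS : S ⊆ rs.Pos) :
    NegCoclosed rs.Pos S ↔ TwoLocallySimple rs S := by
  constructor
  · intro hN X hX hI
    obtain ⟨a, b, ha, hb, hne, hlt, hΔ, hcomb⟩ := aux_structure rs hX hI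
    rcases (S ∩ rs.locPos X).eq_empty_or_nonempty with h | ⟨α, hαS, hα⟩
    · exact Or.inr h
    left
    obtain ⟨x, y, e⟩ := hcomb α hα
    by_cases hx : x = 0
    · have e' : α = (y : ℝ) • b := by rw [e, hx]; simp
      have h1 := aux_smul_one rs hb.1.1.1 (e' ▸ hα.1.1)
      rw [h1, one_smul] at e'
      subst e'
      exact ⟨α, ⟨hαS, hα⟩, hb⟩
    by_cases hy : y = 0
    · have e' : α = (x : ℝ) • a := by rw [e, hy]; simp
      have h1 := aux_smul_one rs ha.1.1.1 (e' ▸ hα.1.1)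
      rw [h1, one_smul] at e'
      subst e'
      exact ⟨α, ⟨hαS, hα⟩, ha⟩
    rcases hN α hαS a ha.1.1 b hb.1.1 x y (by omega) (by omega) (by simpa using e)
      (by rwa [real_inner_comm]) with h | h
    · exact ⟨a, ⟨h, ha.1⟩, ha⟩
    · exact ⟨b, ⟨h, hb.1⟩, hb⟩
  · intro hT α hαS β₁ hβ₁ β₂ hβ₂ d₁ d₂ hd₁ hd₂ e hlt
    have hne : β₂ ≠ β₁ := by
      rintro rfl
      exact absurd (aux_norm_pos rs hβ₂.1) (by linarith)
    have hind := aux_indep_pos rs hβ₁ hβ₂ hne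
    let X : Set (EucV ℓ) := {x : EucV ℓ | ⟪β₁, x⟫_ℝ = 0 ∧ ⟪β₂, x⟫_ℝ = 0}
    have hX : rs.IsCodim2Flat X := ⟨β₁, hβ₁, β₂, hβ₂, hind, rfl⟩
    have h1 : β₁ ∈ rs.locΦ X := ⟨hβ₁.1, fun x hx => hx.1⟩
    have h2 : β₂ ∈ rs.locΦ X := ⟨hβ₂.1, fun x hx => hx.2⟩
    have hI : IrredSet (rs.locΦ X) := by
      have main : ∀ A B : Set (EucV ℓ), B.Nonempty → rs.locΦ X = A ∪ B →
          (∀ a ∈ A, ∀ b ∈ B, ⟪a, b⟫_ℝ = 0) → β₁ ∈ A → False := by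
        rintro A B ⟨b, hb⟩ hAB ho hA
        have hbl : b ∈ rs.locΦ X := hAB ▸ Or.inr hb
        have hA2 : β₂ ∈ A := by
          have : β₂ ∈ A ∪ B := hAB ▸ h2
          rcases this with h | h
          · exact h
          · exact absurd (ho β₁ hA β₂ h) hlt.ne
        obtain ⟨x, y, hxy⟩ := aux_loc_comb rs hX h1 h2 hind hbl
        have : ⟪b, b⟫_ℝ = 0 := by
          have e0 : ⟪b, b⟫_ℝ = ⟪x • β₁ + y • β₂, b⟫_ℝ := by rw [← hxy]
          rw [e0, inner_add_left, inner_smul_left, inner_smul_left, ho _ hA _ hb, ho _ hA2 _ hb]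
          simp
        exact (aux_norm_pos rs hbl.1).ne' this
      rintro ⟨A, B, hA, hB, hAB, ho⟩
      have : β₁ ∈ A ∪ B := hAB ▸ h1
      rcases this with h | h
      · exact main A B hB hAB ho h
      · exact main B A hA (by rw [hAB, Set.union_comm])
          (fun a ha b hb => by rw [real_inner_comm]; exact ho b hb a ha) h
    obtain ⟨a, b, ha, hb, hne', hneg, hΔ, hcomb⟩ := aux_structure rs hX hI
    have hab := aux_indep_pos rs ha.1.1 hb.1.1 hne'
    have hba := aux_indep_pos rs hb.1.1 ha.1.1 hne'.symm
    have hsimp : ∀ β ∈ rs.locPos X, ∀ β' ∈ rs.locPos X, ⟪β, β'⟫_ℝ < 0 → β = a ∨ β = b := by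
      intro β hβ β' hβ' hl
      obtain ⟨x, y, e⟩ := hcomb β hβ
      by_cases hx : x = 0
      · have e' : β = (y : ℝ) • b := by rw [e, hx]; simp
        have h1 := aux_smul_one rs hb.1.1.1 (e' ▸ hβ.1.1)
        rw [h1, one_smul] at e'
        exact Or.inr e'
      by_cases hy : y = 0
      · have e' : β = (x : ℝ) • a := by rw [e, hy]; simp
        have h1 := aux_smul_one rs ha.1.1.1 (e' ▸ hβ.1.1)
        rw [h1, one_smul] at e'
        exact Or.inl e'
      exfalso
      have p1 := aux_dominant rs hirr hG2 ha.1.1.1 hb.1.1.1 hβ.1.1 hab hneg hx hy e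
      have p2 := aux_dominant rs hirr hG2 hb.1.1.1 ha.1.1.1 hβ.1.1 hba
        (by rwa [real_inner_comm]) hy hx (by rw [e, add_comm])
      obtain ⟨u, v, e'⟩ := hcomb β' hβ'
      rw [e', inner_add_right, inner_smul_right, inner_smul_right] at hl
      have := mul_nonneg (Nat.cast_nonneg (α := ℝ) u) p1
      have := mul_nonneg (Nat.cast_nonneg (α := ℝ) v) p2
      linarith
    have s1 := hsimp β₁ ⟨hβ₁, h1⟩ β₂ ⟨hβ₂, h2⟩ hlt
    have s2 := hsimp β₂ ⟨hβ₂, h2⟩ β₁ ⟨hβ₁, h1⟩ (by rwa [real_inner_comm])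
    have hαl : α ∈ S ∩ rs.locPos X := by
      refine ⟨hαS, hS hαS, ?_⟩
      rw [e]
      exact aux_loc_add rs _ _ h1 h2 (e ▸ (hS hαS).1)
    rcases hT X hX hI with ⟨γ, ⟨hγS, -⟩, hγ⟩ | h
    · rw [hΔ] at hγ
      rcases hγ with rfl | rfl <;> rcases s1 with rfl | rfl <;> rcases s2 with rfl | rfl <;>
        first
        | exact Or.inl hγS
        | exact Or.inr hγS
        | exact absurd rfl hne
    · rw [h] at hαl; exact absurd hαl (Set.notMem_empty _)

end
end

section
/- Let Φ be an irreducible crystallographic root system that is not of type G₂. Then a subset Σ ⊆ Φ⁺ is Worpitzky-compatible if and only if Σ is 2-locally simple. -/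
open scoped InnerProductSpace

noncomputable section

variable {ℓ : ℕ}

namespace RootSystemData

theorem exists_dual (rs : RootSystemData ℓ) (g : EucV ℓ → ℝ) :
    ∃ v : EucV ℓ, ∀ b ∈ rs.Δ, ⟪b, v⟫_ℝ = g b := by
  have hli := rs.simple_indep
  let B := Module.Basis.span hli
  let f := B.constr ℝ (fun b : rs.Δ => g b)
  obtain ⟨F, hF⟩ := LinearMap.exists_extend f
  let F' : EucV ℓ →L[ℝ] ℝ := LinearMap.toContinuousLinearMap F
  refine ⟨(InnerProductSpace.toDual ℝ (EucV ℓ)).symm F', fun b hb => ?_⟩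
  rw [real_inner_comm, InnerProductSpace.toDual_symm_apply]
  change F b = g b
  have h1 : ((B ⟨b, hb⟩ : _) : EucV ℓ) = b := by
    simp [B, Module.Basis.span_apply]
  have h2 : F ((B ⟨b, hb⟩ : _) : EucV ℓ) = f (B ⟨b, hb⟩) := by
    rw [← hF]; rfl
  rw [h1] at h2
  rw [h2]
  simp [f, Module.Basis.constr_basis]

theorem inner_int (rs : RootSystemData ℓ) (v : EucV ℓ)
    (h : ∀ b ∈ rs.Δ, ∃ n : ℤ, ⟪b, v⟫_ℝ = n) (α : EucV ℓ) (hα : α ∈ rs.Φ) :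
    ∃ n : ℤ, ⟪α, v⟫_ℝ = n := by
  have key : ∀ α, IsNNIntComb rs.Δ α → ∃ n : ℤ, ⟪α, v⟫_ℝ = n := by
    rintro α ⟨s, c, hs, rfl⟩
    choose! f hf using h
    refine ⟨∑ b ∈ s, (c b : ℤ) * f b, ?_⟩
    rw [sum_inner]
    push_cast
    refine Finset.sum_congr rfl fun b hb => ?_
    rw [real_inner_smul_left, hf b (hs hb)]
  rcases rs.pos_or_neg α hα with h1 | h1
  · exact key α h1
  · obtain ⟨n, hn⟩ := key _ h1
    refine ⟨-n, ?_⟩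
    rw [inner_neg_left] at hn
    push_cast; linarith

theorem exists_ht (rs : RootSystemData ℓ) :
    ∃ v : EucV ℓ, (∀ α ∈ rs.Pos, ∃ n : ℕ, 1 ≤ n ∧ ⟪α, v⟫_ℝ = n) ∧
      (∀ α ∈ rs.Φ, α ∈ rs.Pos ∨ -α ∈ rs.Pos) := by
  obtain ⟨v, hv⟩ := rs.exists_dual (fun _ => 1)
  refine ⟨v, ?_, ?_⟩
  · rintro α ⟨hα, s, c, hs, rfl⟩
    refine ⟨∑ b ∈ s, c b, ?_, ?_⟩
    · rw [Nat.one_le_iff_ne_zero]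
      intro h0
      rw [Finset.sum_eq_zero_iff] at h0
      apply rs.nonzero
      convert hα
      rw [Finset.sum_eq_zero]
      intro b hb
      simp [h0 b hb]
    · rw [sum_inner]
      push_cast
      refine Finset.sum_congr rfl fun b hb => ?_
      rw [real_inner_smul_left, hv b (hs hb), mul_one]
  · intro α hα
    rcases rs.pos_or_neg α hα with h | h
    · exact Or.inl ⟨hα, h⟩
    · exact Or.inr ⟨rs.neg_mem _ hα, h⟩

theorem simple_pos (rs : RootSystemData ℓ) : rs.Δ ⊆ rs.Pos := by
  intro b hb
  refine ⟨rs.simple_sub hb, {b}, fun _ => 1, ?_, ?_⟩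
  · simpa using hb
  · simp

theorem pos_finite (rs : RootSystemData ℓ) : rs.Pos.Finite :=
  rs.finite.subset (fun _ h => h.1)

theorem norm_pos (rs : RootSystemData ℓ) {a : EucV ℓ} (ha : a ∈ rs.Φ) : 0 < ⟪a, a⟫_ℝ := by
  rw [real_inner_self_pos]
  rintro rfl
  exact rs.nonzero ha

/-- reflection with explicit integer coefficient -/
theorem refl_int (rs : RootSystemData ℓ) {a b : EucV ℓ} (ha : a ∈ rs.Φ) (hb : b ∈ rs.Φ)
    {k : ℝ} (hk : 2 * ⟪b, a⟫_ℝ = k * ⟪a, a⟫_ℝ) : b - k • a ∈ rs.Φ := by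
  have := rs.refl_mem a ha b hb
  rwa [hk, mul_div_cancel_right₀ _ (rs.norm_pos ha).ne'] at this

/-- two roots, non proportional -/
def NP (a b : EucV ℓ) : Prop := ¬ ∃ t : ℝ, b = t • a

theorem np_of_indep {a b : EucV ℓ} (ha : a ≠ 0) (h : NP a b) (x y : ℝ)
    (hxy : x • a + y • b = 0) : x = 0 ∧ y = 0 := by
  by_cases hy : y = 0
  · subst hy
    simp [ha] at hxy
    exact ⟨hxy, rfl⟩
  · exfalso
    apply h
    refine ⟨-(x / y), ?_⟩
    have : y • b = -(x • a) := by
      rw [eq_neg_iff_add_eq_zero, add_comm]; exact hxy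
    calc b = y⁻¹ • (y • b) := by rw [smul_smul, inv_mul_cancel₀ hy, one_smul]
      _ = _ := by rw [this, smul_neg, smul_smul, neg_smul]; congr 2; field_simp

theorem cs_strict {a b : EucV ℓ} (ha : a ≠ 0) (h : NP a b) :
    ⟪a, b⟫_ℝ ^ 2 < ⟪a, a⟫_ℝ * ⟪b, b⟫_ℝ := by
  have hN : 0 < ⟪a, a⟫_ℝ := by rwa [real_inner_self_pos]
  have hw : 0 < ⟪⟪a, a⟫_ℝ • b - ⟪a, b⟫_ℝ • a, ⟪a, a⟫_ℝ • b - ⟪a, b⟫_ℝ • a⟫_ℝ := by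
    rw [real_inner_self_pos]
    intro h0
    apply h
    refine ⟨⟪a, b⟫_ℝ / ⟪a, a⟫_ℝ, ?_⟩
    rw [sub_eq_zero] at h0
    calc b = (⟪a, a⟫_ℝ)⁻¹ • (⟪a, a⟫_ℝ • b) := by
          rw [smul_smul, inv_mul_cancel₀ hN.ne', one_smul]
      _ = _ := by rw [h0, smul_smul]; congr 1; field_simp
  simp only [inner_sub_left, inner_sub_right, real_inner_smul_left, real_inner_smul_right,
    real_inner_comm a b] at hw
  have : 0 < ⟪a, a⟫_ℝ * (⟪a, a⟫_ℝ * ⟪b, b⟫_ℝ - ⟪a, b⟫_ℝ ^ 2) := by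
    nlinarith
  have := (mul_pos_iff_of_pos_left hN).1 this
  linarith

end RootSystemData
namespace RootSystemData

/-- no G2 pair -/
def NoG2 (rs : RootSystemData ℓ) : Prop :=
  ∀ a ∈ rs.Φ, ∀ b ∈ rs.Φ, ⟪b, b⟫_ℝ = 3 * ⟪a, a⟫_ℝ → 2 * ⟪b, a⟫_ℝ = -3 * ⟪a, a⟫_ℝ → False

theorem g2_list (u w i j : ℤ) (h1 : u * i + 3 * w * i + w * j = 1)
    (h2 : i * (u ^ 2 + 3 * u * w + 3 * w ^ 2) = u)
    (h3 : j * (u ^ 2 + 3 * u * w + 3 * w ^ 2) = 3 * w) :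
    (2 * u + 3 * w, u + 2 * w) ∈ ({(1, 0), (0, 1), (1, 1), (2, 1), (3, 1), (3, 2),
      (-1, 0), (0, -1), (-1, -1), (-2, -1), (-3, -1), (-3, -2)} : Finset (ℤ × ℤ)) := by
  have hu : -4 ≤ u ∧ u ≤ 4 := by
    by_cases hi : i = 0
    · subst hi; constructor <;> nlinarith
    · have hQ : 0 ≤ u ^ 2 + 3 * u * w + 3 * w ^ 2 := by nlinarith [sq_nonneg (2*u+3*w)]
      have : u ^ 2 + 3 * u * w + 3 * w ^ 2 ≤ |u| := by
        have e : |u| = |i| * (u ^ 2 + 3 * u * w + 3 * w ^ 2) := by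
          rw [← abs_of_nonneg hQ, ← abs_mul, h2]
        rw [e]
        have : 1 ≤ |i| := Int.one_le_abs hi
        nlinarith
      rcases abs_cases u with ⟨h, h'⟩ | ⟨h, h'⟩ <;> rw [h] at this <;>
        constructor <;> nlinarith [sq_nonneg (2 * w + u)]
  have hw : -4 ≤ w ∧ w ≤ 4 := by
    by_cases hi : j = 0
    · subst hi; constructor <;> nlinarith
    · have hQ : 0 ≤ u ^ 2 + 3 * u * w + 3 * w ^ 2 := by nlinarith [sq_nonneg (2*u+3*w)]
      have : u ^ 2 + 3 * u * w + 3 * w ^ 2 ≤ |3 * w| := by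
        have e : |3 * w| = |j| * (u ^ 2 + 3 * u * w + 3 * w ^ 2) := by
          rw [← abs_of_nonneg hQ, ← abs_mul, h3]
        rw [e]
        have : 1 ≤ |j| := Int.one_le_abs hi
        nlinarith
      rcases abs_cases (3 * w) with ⟨h, h'⟩ | ⟨h, h'⟩ <;> rw [h] at this <;>
        constructor <;> nlinarith [sq_nonneg (2 * u + 3 * w)]
  obtain ⟨hu1, hu2⟩ := hu
  obtain ⟨hw1, hw2⟩ := hw
  interval_cases u <;> interval_cases w <;> first | decide | (exfalso; omega)

theorem noG2 (rs : RootSystemData ℓ) (hirr : IrredSet rs.Φ)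
    (hG2 : ¬ (ℓ = 2 ∧ rs.Pos.ncard = 6)) : rs.NoG2 := by
  intro a ha b hb hn hp
  have hN := rs.norm_pos ha
  set N := ⟪a, a⟫_ℝ with hNdef
  have ha0 : a ≠ 0 := by rintro rfl; exact rs.nonzero ha
  have hb0 : b ≠ 0 := by rintro rfl; exact rs.nonzero hb
  have hnp : NP a b := by
    rintro ⟨t, rfl⟩
    simp only [real_inner_smul_left, real_inner_smul_right, ← hNdef] at hn hp
    have h1 : t = -3 / 2 := by
      have : (2 * t + 3) * N = 0 := by linarith
      rcases mul_eq_zero.1 this with h | h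
      · linarith
      · exact absurd h hN.ne'
    subst h1
    nlinarith
  -- structure of any root
  have key : ∀ γ ∈ rs.Φ, (⟪γ, a⟫_ℝ = 0 ∧ ⟪γ, b⟫_ℝ = 0) ∨
      ∃ p ∈ ({(1, 0), (0, 1), (1, 1), (2, 1), (3, 1), (3, 2),
      (-1, 0), (0, -1), (-1, -1), (-2, -1), (-3, -1), (-3, -2)} : Finset (ℤ × ℤ)),
        γ = (p.1 : ℝ) • a + (p.2 : ℝ) • b := by
    intro γ hγ
    obtain ⟨u, hu⟩ := rs.cryst a ha γ hγ
    obtain ⟨w, hw⟩ := rs.cryst b hb γ hγ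
    obtain ⟨i, hi⟩ := rs.cryst γ hγ a ha
    obtain ⟨j, hj⟩ := rs.cryst γ hγ b hb
    have hM := rs.norm_pos hγ
    set M := ⟪γ, γ⟫_ℝ with hMdef
    rw [← hNdef] at hu
    rw [hn] at hw
    rw [real_inner_comm] at hi hj
    by_cases h0 : u = 0 ∧ w = 0
    · left
      obtain ⟨rfl, rfl⟩ := h0
      constructor <;> · push_cast at *; linarith
    right
    -- w3 : 
    set Q : ℤ := u ^ 2 + 3 * u * w + 3 * w ^ 2 with hQ
    have hQpos : 0 < Q := by
      by_contra hneg
      have h4 : (2 * u + 3 * w) ^ 2 + 3 * w ^ 2 ≤ 0 := by nlinarith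
      have hw0 : w = 0 := by nlinarith [sq_nonneg (2 * u + 3 * w), sq_nonneg w]
      subst hw0
      apply h0
      refine ⟨?_, rfl⟩
      nlinarith [sq_nonneg u]
    set z : EucV ℓ := γ - (((2 * u + 3 * w : ℤ) : ℝ) • a + ((u + 2 * w : ℤ) : ℝ) • b) with hz
    have hzz : ⟪z, z⟫_ℝ = M - Q * N := by
      have e1 : ⟪γ, a⟫_ℝ = u * N / 2 := by linarith
      have e2 : ⟪γ, b⟫_ℝ = w * (3 * N) / 2 := by linarith
      have e3 : ⟪b, a⟫_ℝ = -3 * N / 2 := by linarith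
      rw [hz]
      simp only [inner_sub_left, inner_sub_right, inner_add_left, inner_add_right,
        real_inner_smul_left, real_inner_smul_right]
      rw [real_inner_comm γ a, real_inner_comm γ b, real_inner_comm b a, e1, e2, e3, hn,
        ← hNdef, ← hMdef, hQ]
      push_cast
      ring
    have hle : (Q : ℝ) * N ≤ M := by
      have : 0 ≤ ⟪z, z⟫_ℝ := real_inner_self_nonneg
      linarith
    have e1 : (u : ℝ) * N = i * M := by linarith
    have e2 : (w : ℝ) * (3 * N) = j * M := by linarith
    have e3 : ((u * i + 3 * w * i + w * j : ℤ) : ℝ) * M = Q * N := by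
      rw [hQ]; push_cast; linear_combination (-(u : ℝ) - 3 * w) * e1 - w * e2
    have hone : u * i + 3 * w * i + w * j = 1 := by
      have hQr : (0 : ℝ) < Q := by exact_mod_cast hQpos
      have h1 : (0 : ℝ) < ((u * i + 3 * w * i + w * j : ℤ) : ℝ) := by
        by_contra hc
        push Not at hc
        nlinarith [mul_pos hQr hN]
      have h2 : ((u * i + 3 * w * i + w * j : ℤ) : ℝ) ≤ 1 := by
        by_contra hc
        push Not at hc
        nlinarith
      have h1' : 0 < u * i + 3 * w * i + w * j := by exact_mod_cast h1
      have h2' : u * i + 3 * w * i + w * j ≤ 1 := by exact_mod_cast h2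
      omega
    rw [hone] at e3
    have hMQ : M = Q * N := by simpa using e3
    have hz0 : z = 0 := by
      rw [← inner_self_eq_zero (𝕜 := ℝ), hzz, hMQ, sub_self]
    refine ⟨(2 * u + 3 * w, u + 2 * w), g2_list u w i j hone ?_ ?_, sub_eq_zero.1 hz0⟩
    · have : (i : ℝ) * Q = u := by
        apply mul_right_cancel₀ hN.ne'
        rw [e1, hMQ]; ring
      exact_mod_cast this
    · have : (j : ℝ) * Q = 3 * w := by
        apply mul_right_cancel₀ hN.ne'
        have := e2
        rw [hMQ] at this
        linarith
      exact_mod_cast this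
  have all : ∀ γ ∈ rs.Φ, ∃ p ∈ ({(1, 0), (0, 1), (1, 1), (2, 1), (3, 1), (3, 2),
      (-1, 0), (0, -1), (-1, -1), (-2, -1), (-3, -1), (-3, -2)} : Finset (ℤ × ℤ)),
        γ = (p.1 : ℝ) • a + (p.2 : ℝ) • b := by
    intro γ hγ
    by_contra hc
    apply hirr
    refine ⟨{γ ∈ rs.Φ | ⟪γ, a⟫_ℝ = 0 ∧ ⟪γ, b⟫_ℝ = 0}, {γ ∈ rs.Φ | ∃ p : ℤ × ℤ,
        γ = (p.1 : ℝ) • a + (p.2 : ℝ) • b}, ⟨γ, hγ, (key γ hγ).resolve_right hc⟩,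
        ⟨a, ha, (1, 0), by simp⟩, ?_, ?_⟩
    · ext δ
      constructor
      · intro h
        rcases key δ h with h' | ⟨p, _, h'⟩
        · exact Or.inl ⟨h, h'⟩
        · exact Or.inr ⟨h, p, h'⟩
      · rintro (h | h) <;> exact h.1
    · rintro x ⟨_, h1, h2⟩ y ⟨_, p, rfl⟩
      rw [inner_add_right, real_inner_smul_right, real_inner_smul_right, h1, h2]
      simp
  have hba : ⟪b, a⟫_ℝ = -3 * N / 2 := by linarith
  have hab : ⟪a, b⟫_ℝ = -3 * N / 2 := by rw [real_inner_comm]; exact hba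
  have r3 : (3 : ℝ) • a + b ∈ rs.Φ := by
    have := rs.refl_int ha hb (k := -3) (by linarith)
    convert this using 1
    module
  have r1 : a + b ∈ rs.Φ := by
    have := rs.refl_int hb ha (k := -1) (by rw [hab, hn]; ring)
    convert this using 1
    module
  have r2 : (2 : ℝ) • a + b ∈ rs.Φ := by
    have := rs.refl_int ha r1 (k := -1) (by rw [inner_add_left, hba]; ring)
    convert this using 1
    module
  have r4 : (3 : ℝ) • a + (2 : ℝ) • b ∈ rs.Φ := by
    have := rs.refl_int hb r3 (k := -1) (by
      rw [inner_add_left, real_inner_smul_left, hab, hn]; ring)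
    convert this using 1
    module
  let f : ℤ × ℤ → EucV ℓ := fun p => (p.1 : ℝ) • a + (p.2 : ℝ) • b
  have finj : Function.Injective f := by
    intro p q hpq
    have h : ((p.1 : ℝ) - q.1) • a + ((p.2 : ℝ) - q.2) • b = 0 := by
      have : f p - f q = 0 := sub_eq_zero.2 hpq
      rw [← this]
      simp only [f]
      module
    obtain ⟨h1, h2⟩ := np_of_indep ha0 hnp _ _ h
    ext
    · exact_mod_cast sub_eq_zero.1 h1
    · exact_mod_cast sub_eq_zero.1 h2
  have hΦ : rs.Φ = f '' (({(1, 0), (0, 1), (1, 1), (2, 1), (3, 1), (3, 2),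
      (-1, 0), (0, -1), (-1, -1), (-2, -1), (-3, -1), (-3, -2)} : Finset (ℤ × ℤ)) :
        Set (ℤ × ℤ)) := by
    apply Set.Subset.antisymm
    · intro γ hγ
      obtain ⟨p, hp, h⟩ := all γ hγ
      exact ⟨p, hp, h.symm⟩
    · rintro _ ⟨p, hp, rfl⟩
      have n1 := rs.neg_mem _ r1
      have n2 := rs.neg_mem _ r2
      have n3 := rs.neg_mem _ r3
      have n4 := rs.neg_mem _ r4
      have n5 := rs.neg_mem _ ha
      have n6 := rs.neg_mem _ hb
      simp only [Finset.coe_insert, Finset.coe_singleton, Set.mem_insert_iff,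
        Set.mem_singleton_iff] at hp
      rcases hp with rfl | rfl | rfl | rfl | rfl | rfl | rfl | rfl | rfl | rfl | rfl | rfl
      · convert ha using 1; simp [f]
      · convert hb using 1; simp [f]
      · convert r1 using 1; simp [f]
      · convert r2 using 1; simp [f]
      · convert r3 using 1; simp [f]
      · convert r4 using 1; simp [f]
      · convert n5 using 1; simp [f]
      · convert n6 using 1; simp [f]
      · convert n1 using 1; simp only [f]; push_cast; module
      · convert n2 using 1; simp only [f]; push_cast; module
      · convert n3 using 1; simp only [f]; push_cast; module
      · convert n4 using 1; simp only [f]; push_cast; module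
  have hcard : rs.Φ.ncard = 12 := by
    rw [hΦ, Set.ncard_image_of_injective _ finj, Set.ncard_coe_finset]
    rfl
  obtain ⟨v, hv, hpn⟩ := rs.exists_ht
  have hsplit : rs.Φ = rs.Pos ∪ (fun x => -x) '' rs.Pos := by
    ext x
    constructor
    · intro hx
      rcases hpn x hx with h | h
      · exact Or.inl h
      · exact Or.inr ⟨-x, h, neg_neg x⟩
    · rintro (h | ⟨y, h, rfl⟩)
      · exact h.1
      · exact rs.neg_mem _ h.1
  have hdisj : Disjoint rs.Pos ((fun x => -x) '' rs.Pos) := by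
    rw [Set.disjoint_left]
    rintro x hx ⟨y, hy, rfl⟩
    obtain ⟨n, hn, h1⟩ := hv _ hx
    obtain ⟨m, hm, h2⟩ := hv _ hy
    rw [inner_neg_left, h2] at h1
    have : (1 : ℝ) ≤ n := by exact_mod_cast hn
    have : (1 : ℝ) ≤ m := by exact_mod_cast hm
    linarith
  rw [hsplit, Set.ncard_union_eq hdisj rs.pos_finite (rs.pos_finite.image _),
    Set.ncard_image_of_injective _ neg_injective] at hcard
  apply hG2
  refine ⟨?_, by omega⟩
  have hspan : Submodule.span ℝ (Set.range ![a, b]) = ⊤ := by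
    rw [eq_top_iff, ← rs.spanning, Submodule.span_le]
    intro γ hγ
    obtain ⟨p, _, rfl⟩ := all γ hγ
    apply Submodule.add_mem <;> apply Submodule.smul_mem <;> apply Submodule.subset_span
    · exact ⟨0, rfl⟩
    · exact ⟨1, rfl⟩
  have hli : LinearIndependent ℝ ![a, b] := by
    rw [LinearIndependent.pair_iff]
    exact fun s t h => np_of_indep ha0 hnp s t h
  have := finrank_span_eq_card hli
  rw [hspan] at this
  simpa using this

end RootSystemData
namespace RootSystemData

theorem prod_le (rs : RootSystemData ℓ) (h2 : rs.NoG2) {a b : EucV ℓ} (ha : a ∈ rs.Φ)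
    (hb : b ∈ rs.Φ) (hnp : NP a b) {k l : ℤ} (hk : 2 * ⟪b, a⟫_ℝ = k * ⟪a, a⟫_ℝ)
    (hl : 2 * ⟪a, b⟫_ℝ = l * ⟪b, b⟫_ℝ) :
    0 ≤ k * l ∧ k * l ≤ 2 ∧ (k = 0 ↔ l = 0) := by
  have hN := rs.norm_pos ha
  have hM := rs.norm_pos hb
  have ha0 : a ≠ 0 := by rintro rfl; exact rs.nonzero ha
  have hcs := cs_strict ha0 hnp
  rw [real_inner_comm] at hk
  set P := ⟪a, b⟫_ℝ with hP
  set N := ⟪a, a⟫_ℝ with hNd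
  set M := ⟪b, b⟫_ℝ with hMd
  have hNM := mul_pos hN hM
  have e : ((k * l : ℤ) : ℝ) * (N * M) = 4 * P ^ 2 := by
    push_cast
    linear_combination (-(l : ℝ) * M) * hk - 2 * P * hl
  have h0 : 0 ≤ k * l := by
    have : (0 : ℝ) ≤ ((k * l : ℤ) : ℝ) := by
      by_contra hc
      push Not at hc
      nlinarith [sq_nonneg P]
    exact_mod_cast this
  have h4 : k * l < 4 := by
    have : ((k * l : ℤ) : ℝ) < 4 := by
      by_contra hc
      push Not at hc
      nlinarith [sq_nonneg P]
    exact_mod_cast this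
  have hiff : k = 0 ↔ l = 0 := by
    constructor
    · rintro rfl
      have : (l : ℝ) * M = 0 := by rw [← hl, hk]; simp
      have := (mul_eq_zero.1 this).resolve_right hM.ne'
      exact_mod_cast this
    · rintro rfl
      have : (k : ℝ) * N = 0 := by rw [← hk, hl]; simp
      have := (mul_eq_zero.1 this).resolve_right hN.ne'
      exact_mod_cast this
  refine ⟨h0, ?_, hiff⟩
  by_contra hc
  have h3 : k * l = 3 := by omega
  have hkd : k ∣ 3 := ⟨l, h3.symm⟩
  have hk3 : k ≤ 3 := Int.le_of_dvd (by norm_num) hkd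
  have hk3' : -3 ≤ k := by
    have : -k ∣ 3 := (neg_dvd).2 hkd
    have := Int.le_of_dvd (by norm_num) this
    omega
  have hna := rs.neg_mem _ ha
  have hnb := rs.neg_mem _ hb
  have hP' : ⟪b, a⟫_ℝ = P := by rw [hP, real_inner_comm]
  interval_cases k
  · have : l = -1 := by omega
    subst this
    push_cast at hk hl
    refine h2 a ha b hb ?_ ?_ <;> simp only [hP', ← hNd, ← hMd] <;> linarith
  · omega
  · have : l = -3 := by omega
    subst this
    push_cast at hk hl
    refine h2 b hb a ha ?_ ?_ <;> simp only [← hP, ← hNd, ← hMd] <;> linarith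
  · omega
  · have : l = 3 := by omega
    subst this
    push_cast at hk hl
    refine h2 b hb (-a) hna ?_ ?_ <;> simp only [inner_neg_left, inner_neg_right, ← hP, ← hNd, ← hMd] <;> linarith
  · omega
  · have : l = 1 := by omega
    subst this
    push_cast at hk hl
    refine h2 a ha (-b) hnb ?_ ?_ <;> simp only [inner_neg_left, inner_neg_right, hP', ← hNd, ← hMd] <;> linarith

theorem bnd {k l : ℤ} (h : 0 ≤ k * l ∧ k * l ≤ 2 ∧ (k = 0 ↔ l = 0)) :
    -2 ≤ k ∧ k ≤ 2 ∧ -2 ≤ l ∧ l ≤ 2 := by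
  obtain ⟨h0, h1, h2⟩ := h
  by_cases hk : k = 0
  · have := h2.1 hk; omega
  · have hl : l ≠ 0 := fun h => hk (h2.2 h)
    rcases lt_or_gt_of_ne hk with h | h <;> rcases lt_or_gt_of_ne hl with h' | h' <;>
      refine ⟨?_, ?_, ?_, ?_⟩ <;> nlinarith

theorem gram {N₁ N₂ P : ℝ} (h1 : 0 < N₁) (h2 : 0 < N₂) (h3 : 0 < N₁ + N₂ + 2 * P)
    {k l k' l' k'' l'' : ℤ}
    (hk : 2 * P = k * N₁) (hl : 2 * P = l * N₂)
    (hk' : 2 * (N₁ + P) = k' * N₁) (hl' : 2 * (N₁ + P) = l' * (N₁ + N₂ + 2 * P))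
    (hk'' : 2 * (N₂ + P) = k'' * N₂) (hl'' : 2 * (N₂ + P) = l'' * (N₁ + N₂ + 2 * P))
    (b : 0 ≤ k * l ∧ k * l ≤ 2 ∧ (k = 0 ↔ l = 0))
    (b' : 0 ≤ k' * l' ∧ k' * l' ≤ 2 ∧ (k' = 0 ↔ l' = 0))
    (b'' : 0 ≤ k'' * l'' ∧ k'' * l'' ≤ 2 ∧ (k'' = 0 ↔ l'' = 0)) :
    (P = 0 ∧ N₁ = N₂) ∨ (2 * P = -N₁ ∧ N₁ = N₂) ∨ (N₁ = 2 * N₂ ∧ P = -N₂) ∨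
      (N₂ = 2 * N₁ ∧ P = -N₁) := by
  have ek : k' = k + 2 := by
    have : (k' : ℝ) = k + 2 := by
      apply mul_right_cancel₀ h1.ne'; linarith
    exact_mod_cast this
  have ek' : k'' = l + 2 := by
    have : (k'' : ℝ) = l + 2 := by
      apply mul_right_cancel₀ h2.ne'; linarith
    exact_mod_cast this
  subst ek ek'
  obtain ⟨c1, c2, c3, c4⟩ := bnd b
  obtain ⟨d1, d2, d3, d4⟩ := bnd b'
  obtain ⟨e1, e2, e3, e4⟩ := bnd b''
  have hk0 : k ≤ 0 := by omega
  have hl0 : l ≤ 0 := by omega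
  clear hk' hk'' c2 c4 d1 d2 e1 e2
  interval_cases k <;> interval_cases l <;> norm_num at b
  · -- -2,-1
    push_cast at hk hl
    right; right; right; constructor <;> linarith
  · push_cast at hk hl
    right; right; left; constructor <;> linarith
  · push_cast at hk hl
    right; left; constructor <;> linarith
  · push_cast at hk hl
    have f1 : l' ≤ 1 := by omega
    have f2 : l'' ≤ 1 := by omega
    have f1' : (l' : ℝ) ≤ 1 := by exact_mod_cast f1
    have f2' : (l'' : ℝ) ≤ 1 := by exact_mod_cast f2
    left
    have hP : P = 0 := by linarith
    subst hP
    refine ⟨rfl, ?_⟩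
    apply le_antisymm <;> nlinarith

theorem arith_orth {u w i j : ℤ} (hu : u ≠ 0) (hw : w ≠ 0)
    (hi : i * (u ^ 2 + w ^ 2) = 4 * u) (hj : j * (u ^ 2 + w ^ 2) = 4 * w)
    (bi : 0 ≤ u * i ∧ u * i ≤ 2 ∧ (u = 0 ↔ i = 0))
    (bj : 0 ≤ w * j ∧ w * j ≤ 2 ∧ (w = 0 ↔ j = 0)) :
    (u = 1 ∨ u = -1 ∨ u = 2 ∨ u = -2) ∧ (w = u ∨ w = -u) := by
  obtain ⟨c1, c2, c3, c4⟩ := bnd bi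
  obtain ⟨d1, d2, d3, d4⟩ := bnd bj
  clear c3 c4 d3 d4
  interval_cases u <;> interval_cases w <;> omega

theorem arith_A2 {u w i j : ℤ}
    (hi : i * (u ^ 2 + u * w + w ^ 2) = 3 * u) (hj : j * (u ^ 2 + u * w + w ^ 2) = 3 * w)
    (bi : 0 ≤ u * i ∧ u * i ≤ 2 ∧ (u = 0 ↔ i = 0))
    (bj : 0 ≤ w * j ∧ w * j ≤ 2 ∧ (w = 0 ↔ j = 0)) :
    w = u ∧ (u = 0 ∨ u = 1 ∨ u = -1) := by
  obtain ⟨c1, c2, c3, c4⟩ := bnd bi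
  obtain ⟨d1, d2, d3, d4⟩ := bnd bj
  clear c3 c4 d3 d4
  interval_cases u <;> interval_cases w <;> omega

theorem arith_B2 {u w i j : ℤ}
    (hi : i * (2 * u ^ 2 + 2 * u * w + w ^ 2) = 4 * u)
    (hj : j * (2 * u ^ 2 + 2 * u * w + w ^ 2) = 2 * w)
    (bi : 0 ≤ u * i ∧ u * i ≤ 2 ∧ (u = 0 ↔ i = 0))
    (bj : 0 ≤ w * j ∧ w * j ≤ 2 ∧ (w = 0 ↔ j = 0)) :
    (u = 0 ∧ w = 0) ∨ (u = 0 ∧ (w = 1 ∨ w = -1 ∨ w = 2 ∨ w = -2)) ∨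
      (w = 0 ∧ (u = 1 ∨ u = -1 ∨ u = 2 ∨ u = -2)) := by
  obtain ⟨c1, c2, c3, c4⟩ := bnd bi
  obtain ⟨d1, d2, d3, d4⟩ := bnd bj
  clear c3 c4 d3 d4
  interval_cases u <;> interval_cases w <;> omega

theorem np_comb {a b : EucV ℓ} (ha : a ≠ 0) (h : NP a b) {x y : ℝ} (hy : y ≠ 0) :
    NP a (x • a + y • b) := by
  rintro ⟨c, hc⟩
  have : (x - c) • a + y • b = 0 := by
    rw [← sub_eq_zero] at hc
    rw [← hc]; module
  exact hy (np_of_indep ha h _ _ this).2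

theorem np_comb' {a b : EucV ℓ} (ha : a ≠ 0) (h : NP a b) {x y : ℝ} (hx : x ≠ 0) :
    NP b (x • a + y • b) := by
  rintro ⟨c, hc⟩
  have : x • a + (y - c) • b = 0 := by
    rw [← sub_eq_zero] at hc
    rw [← hc]; module
  exact hx (np_of_indep ha h _ _ this).1

def R2 (a b δ : EucV ℓ) : Prop :=
  (δ = a ∨ δ = b ∨ δ = a + b ∨ δ = a - b ∨ δ = (2 : ℝ) • a + b ∨ δ = a + (2 : ℝ) • b) ∨
  (-δ = a ∨ -δ = b ∨ -δ = a + b ∨ -δ = a - b ∨ -δ = (2 : ℝ) • a + b ∨ -δ = a + (2 : ℝ) • b)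

theorem not_mul (rs : RootSystemData ℓ) {a : EucV ℓ} (ha : a ∈ rs.Φ) (t : ℝ) (h1 : t ≠ 1)
    (h2 : t ≠ -1) (h : t • a ∈ rs.Φ) : False := by
  rcases rs.reduced a ha t h with h | h
  · exact h1 h
  · exact h2 h

/-- B2 case with first root long. -/
theorem rank2_B (rs : RootSystemData ℓ) (h2 : rs.NoG2) {a b δ : EucV ℓ} (ha : a ∈ rs.Φ)
    (hb : b ∈ rs.Φ) (hab : a + b ∈ rs.Φ) (hnp : NP a b) (hδ : δ ∈ rs.Φ) {s t : ℝ}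
    (hs : s ≠ 0) (ht : t ≠ 0)
    (hst : δ = s • a + t • b) (g1 : ⟪a, a⟫_ℝ = 2 * ⟪b, b⟫_ℝ) (g2 : ⟪a, b⟫_ℝ = -⟪b, b⟫_ℝ) :
    δ = a + b ∨ -δ = a + b ∨ δ = a + (2 : ℝ) • b ∨ -δ = a + (2 : ℝ) • b := by
  have ha0 : a ≠ 0 := by rintro rfl; exact rs.nonzero ha
  have hN := rs.norm_pos hb
  have hM := rs.norm_pos hδ
  have g3 : ⟪b, a⟫_ℝ = -⟪b, b⟫_ℝ := by rw [real_inner_comm]; exact g2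
  obtain ⟨u, hu⟩ := rs.cryst a ha δ hδ
  obtain ⟨w, hw⟩ := rs.cryst b hb δ hδ
  obtain ⟨i, hi⟩ := rs.cryst δ hδ a ha
  obtain ⟨j, hj⟩ := rs.cryst δ hδ b hb
  have bi := rs.prod_le h2 ha hδ (hst ▸ np_comb ha0 hnp ht) hu hi
  have bj := rs.prod_le h2 hb hδ (hst ▸ np_comb' ha0 hnp hs) hw hj
  rw [real_inner_comm] at hi hj
  have m1 : ⟪δ, a⟫_ℝ = (2 * s - t) * ⟪b, b⟫_ℝ := by
    rw [hst, inner_add_left, real_inner_smul_left, real_inner_smul_left, g1, g3]; ring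
  have m2 : ⟪δ, b⟫_ℝ = (t - s) * ⟪b, b⟫_ℝ := by
    rw [hst, inner_add_left, real_inner_smul_left, real_inner_smul_left, g2]; ring
  have m3 : ⟪δ, δ⟫_ℝ = (2 * s ^ 2 - 2 * s * t + t ^ 2) * ⟪b, b⟫_ℝ := by
    nth_rewrite 2 [hst]
    rw [inner_add_right, real_inner_smul_right, real_inner_smul_right, m1, m2]; ring
  rw [m1, g1] at hu
  rw [m2] at hw
  rw [m1, m3] at hi
  rw [m2, m3] at hj
  have eu : 2 * s - t = u := by apply mul_right_cancel₀ hN.ne'; linarith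
  have ew : 2 * (t - s) = w := by apply mul_right_cancel₀ hN.ne'; linarith
  have ei : 2 * (2 * s - t) = i * (2 * s ^ 2 - 2 * s * t + t ^ 2) := by
    apply mul_right_cancel₀ hN.ne'; linarith
  have ej : 2 * (t - s) = j * (2 * s ^ 2 - 2 * s * t + t ^ 2) := by
    apply mul_right_cancel₀ hN.ne'; linarith
  have es : s = u + w / 2 := by linarith
  have et : t = u + w := by linarith
  have A := arith_B2 (u := u) (w := w) (i := i) (j := j)
    (by
      have : (i : ℝ) * (2 * u ^ 2 + 2 * u * w + w ^ 2) = 4 * u := by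
        rw [es, et] at ei; linear_combination -2 * ei
      exact_mod_cast this)
    (by
      have : (j : ℝ) * (2 * u ^ 2 + 2 * u * w + w ^ 2) = 2 * w := by
        rw [es, et] at ej; linear_combination -2 * ej
      exact_mod_cast this) bi bj
  have hr : a + (2 : ℝ) • b ∈ rs.Φ := by
    have := rs.refl_int hb ha (k := -2) (by rw [g2]; ring)
    convert this using 1
    module
  rcases A with ⟨rfl, rfl⟩ | ⟨rfl, h⟩ | ⟨rfl, h⟩
  · exfalso; apply hs; rw [es]; simp
  · rcases h with rfl | rfl | rfl | rfl <;> norm_num at es et <;> subst es et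
    · exfalso
      refine rs.not_mul hr (1/2) (by norm_num) (by norm_num) ?_
      convert hδ using 1; rw [hst]; module
    · exfalso
      refine rs.not_mul hr (-1/2) (by norm_num) (by norm_num) ?_
      convert hδ using 1; rw [hst]; module
    · right; right; left; rw [hst]; module
    · right; right; right; rw [hst]; module
  · rcases h with rfl | rfl | rfl | rfl <;> norm_num at es et <;> subst es et
    · left; rw [hst]; module
    · right; left; rw [hst]; module
    · exfalso
      refine rs.not_mul hab 2 (by norm_num) (by norm_num) ?_
      convert hδ using 1; rw [hst]; module
    · exfalso
      refine rs.not_mul hab (-2) (by norm_num) (by norm_num) ?_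
      convert hδ using 1; rw [hst]; module

theorem rank2 (rs : RootSystemData ℓ) (h2 : rs.NoG2) {a b δ : EucV ℓ} (ha : a ∈ rs.Φ)
    (hb : b ∈ rs.Φ) (hab : a + b ∈ rs.Φ) (hnp : NP a b) (hδ : δ ∈ rs.Φ) {s t : ℝ}
    (hst : δ = s • a + t • b) : R2 a b δ := by
  have ha0 : a ≠ 0 := by rintro rfl; exact rs.nonzero ha
  have hb0 : b ≠ 0 := by rintro rfl; exact rs.nonzero hb
  by_cases ht : t = 0
  · subst ht
    have e : δ = s • a := by rw [hst]; simp
    rcases rs.reduced a ha s (e ▸ hδ) with rfl | rfl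
    · left; left; rw [e]; simp
    · right; left; rw [e]; simp
  by_cases hs : s = 0
  · subst hs
    have e : δ = t • b := by rw [hst]; simp
    rcases rs.reduced b hb t (e ▸ hδ) with rfl | rfl
    · left; right; left; rw [e]; simp
    · right; right; left; rw [e]; simp
  have hN1 := rs.norm_pos ha
  have hN2 := rs.norm_pos hb
  have hN3 := rs.norm_pos hab
  have hM := rs.norm_pos hδ
  have hnp' : NP b a := by
    have := np_comb' ha0 hnp (x := 1) (y := 0) one_ne_zero
    simpa using this
  have hcomm : ⟪b, a⟫_ℝ = ⟪a, b⟫_ℝ := real_inner_comm _ _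
  have n1 : NP a (a + b) := by
    have := np_comb ha0 hnp (x := 1) (y := 1) one_ne_zero
    simpa using this
  have n2 : NP b (a + b) := by
    have := np_comb' ha0 hnp (x := 1) (y := 1) one_ne_zero
    simpa using this
  have e3 : ⟪a + b, a + b⟫_ℝ = ⟪a, a⟫_ℝ + ⟪b, b⟫_ℝ + 2 * ⟪a, b⟫_ℝ := by
    rw [inner_add_left, inner_add_right, inner_add_right, hcomm]; ring
  have ea : ⟪a + b, a⟫_ℝ = ⟪a, a⟫_ℝ + ⟪a, b⟫_ℝ := by rw [inner_add_left, hcomm]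
  have eb : ⟪a + b, b⟫_ℝ = ⟪b, b⟫_ℝ + ⟪a, b⟫_ℝ := by rw [inner_add_left, add_comm]
  have G : (⟪a, b⟫_ℝ = 0 ∧ ⟪a, a⟫_ℝ = ⟪b, b⟫_ℝ) ∨
      (2 * ⟪a, b⟫_ℝ = -⟪a, a⟫_ℝ ∧ ⟪a, a⟫_ℝ = ⟪b, b⟫_ℝ) ∨
      (⟪a, a⟫_ℝ = 2 * ⟪b, b⟫_ℝ ∧ ⟪a, b⟫_ℝ = -⟪b, b⟫_ℝ) ∨
      (⟪b, b⟫_ℝ = 2 * ⟪a, a⟫_ℝ ∧ ⟪a, b⟫_ℝ = -⟪a, a⟫_ℝ) := by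
    obtain ⟨k, hk⟩ := rs.cryst a ha b hb
    obtain ⟨l, hl⟩ := rs.cryst b hb a ha
    obtain ⟨k', hk'⟩ := rs.cryst a ha _ hab
    obtain ⟨l', hl'⟩ := rs.cryst _ hab a ha
    obtain ⟨k'', hk''⟩ := rs.cryst b hb _ hab
    obtain ⟨l'', hl''⟩ := rs.cryst _ hab b hb
    have b1 := rs.prod_le h2 ha hb hnp hk hl
    have b2 := rs.prod_le h2 ha hab n1 hk' hl'
    have b3 := rs.prod_le h2 hb hab n2 hk'' hl''
    rw [hcomm] at hk
    rw [real_inner_comm] at hl' hl''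
    rw [ea] at hk' hl'
    rw [eb] at hk'' hl''
    rw [e3] at hl' hl'' hN3
    exact gram hN1 hN2 hN3 hk hl hk' hl' hk'' hl'' b1 b2 b3
  rcases G with ⟨g2, g1⟩ | ⟨g2, g1⟩ | ⟨g1, g2⟩ | ⟨g1, g2⟩
  rotate_left 2
  · rcases rs.rank2_B h2 ha hb hab hnp hδ hs ht hst g1 g2 with h | h | h | h
    · left; simp [h]
    · right; simp [h]
    · left; simp [h]
    · right; simp [h]
  · rcases rs.rank2_B h2 hb ha (by rwa [add_comm]) hnp' hδ ht hs (by rw [hst, add_comm]) g1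
      (by rw [hcomm, g2]) with h | h | h | h
    · left; right; right; left; rw [h, add_comm]
    · right; right; right; left; rw [h, add_comm]
    · left; right; right; right; right; left; rw [h, add_comm]
    · right; right; right; right; right; left; rw [h, add_comm]
  all_goals
    obtain ⟨u, hu⟩ := rs.cryst a ha δ hδ
    obtain ⟨w, hw⟩ := rs.cryst b hb δ hδ
    obtain ⟨i, hi⟩ := rs.cryst δ hδ a ha
    obtain ⟨j, hj⟩ := rs.cryst δ hδ b hb
    have bi := rs.prod_le h2 ha hδ (hst ▸ np_comb ha0 hnp ht) hu hi
    have bj := rs.prod_le h2 hb hδ (hst ▸ np_comb' ha0 hnp hs) hw hj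
    rw [real_inner_comm] at hi hj
    rw [g1] at hu
  · have m1 : ⟪δ, a⟫_ℝ = s * ⟪b, b⟫_ℝ := by
      rw [hst, inner_add_left, real_inner_smul_left, real_inner_smul_left, g1, hcomm, g2]; ring
    have m2 : ⟪δ, b⟫_ℝ = t * ⟪b, b⟫_ℝ := by
      rw [hst, inner_add_left, real_inner_smul_left, real_inner_smul_left, g2]; ring
    have m3 : ⟪δ, δ⟫_ℝ = (s ^ 2 + t ^ 2) * ⟪b, b⟫_ℝ := by
      nth_rewrite 2 [hst]
      rw [inner_add_right, real_inner_smul_right, real_inner_smul_right, m1, m2]; ring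
    rw [m1] at hu
    rw [m2] at hw
    rw [m1, m3] at hi
    rw [m2, m3] at hj
    have eu : 2 * s = u := by apply mul_right_cancel₀ hN2.ne'; linarith
    have ew : 2 * t = w := by apply mul_right_cancel₀ hN2.ne'; linarith
    have ei : 2 * s = i * (s ^ 2 + t ^ 2) := by
      apply mul_right_cancel₀ hN2.ne'; linarith
    have ej : 2 * t = j * (s ^ 2 + t ^ 2) := by
      apply mul_right_cancel₀ hN2.ne'; linarith
    have es : s = u / 2 := by linarith
    have et : t = w / 2 := by linarith
    have A := arith_orth (u := u) (w := w) (i := i) (j := j)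
      (by rintro rfl; apply hs; rw [es]; simp) (by rintro rfl; apply ht; rw [et]; simp)
      (by
        have : (i : ℝ) * (u ^ 2 + w ^ 2) = 4 * u := by
          rw [es, et] at ei; linear_combination -4 * ei
        exact_mod_cast this)
      (by
        have : (j : ℝ) * (u ^ 2 + w ^ 2) = 4 * w := by
          rw [es, et] at ej; linear_combination -4 * ej
        exact_mod_cast this) bi bj
    have hr : a - b ∈ rs.Φ := by
      have := rs.refl_int hb hab (k := 2) (by rw [eb, g2]; ring)
      convert this using 1
      module
    obtain ⟨h, h'⟩ := A
    rcases h with rfl | rfl | rfl | rfl <;> rcases h' with rfl | rfl <;>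
      norm_num at es et <;> subst es et
    · exfalso
      refine rs.not_mul hab (1/2) (by norm_num) (by norm_num) ?_
      convert hδ using 1; rw [hst]; module
    · exfalso
      refine rs.not_mul hr (1/2) (by norm_num) (by norm_num) ?_
      convert hδ using 1; rw [hst]; module
    · exfalso
      refine rs.not_mul hab (-1/2) (by norm_num) (by norm_num) ?_
      convert hδ using 1; rw [hst]; module
    · exfalso
      refine rs.not_mul hr (-1/2) (by norm_num) (by norm_num) ?_
      convert hδ using 1; rw [hst]; module
    · left; right; right; left; rw [hst]; module
    · left; right; right; right; left; rw [hst]; module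
    · right; right; right; left; rw [hst]; module
    · right; right; right; right; left; rw [hst]; module
  · have g2' : ⟪a, b⟫_ℝ = -⟪b, b⟫_ℝ / 2 := by linarith
    have m1 : ⟪δ, a⟫_ℝ = (s - t / 2) * ⟪b, b⟫_ℝ := by
      rw [hst, inner_add_left, real_inner_smul_left, real_inner_smul_left, g1, hcomm, g2']; ring
    have m2 : ⟪δ, b⟫_ℝ = (t - s / 2) * ⟪b, b⟫_ℝ := by
      rw [hst, inner_add_left, real_inner_smul_left, real_inner_smul_left, g2']; ring
    have m3 : ⟪δ, δ⟫_ℝ = (s ^ 2 - s * t + t ^ 2) * ⟪b, b⟫_ℝ := by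
      nth_rewrite 2 [hst]
      rw [inner_add_right, real_inner_smul_right, real_inner_smul_right, m1, m2]; ring
    rw [m1] at hu
    rw [m2] at hw
    rw [m1, m3] at hi
    rw [m2, m3] at hj
    have eu : 2 * s - t = u := by apply mul_right_cancel₀ hN2.ne'; linarith
    have ew : 2 * t - s = w := by apply mul_right_cancel₀ hN2.ne'; linarith
    have ei : 2 * s - t = i * (s ^ 2 - s * t + t ^ 2) := by
      apply mul_right_cancel₀ hN2.ne'; linarith
    have ej : 2 * t - s = j * (s ^ 2 - s * t + t ^ 2) := by
      apply mul_right_cancel₀ hN2.ne'; linarith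
    have es : s = (2 * u + w) / 3 := by linarith
    have et : t = (u + 2 * w) / 3 := by linarith
    obtain ⟨rfl, h⟩ := arith_A2 (u := u) (w := w) (i := i) (j := j)
      (by
        have : (i : ℝ) * (u ^ 2 + u * w + w ^ 2) = 3 * u := by
          rw [es, et] at ei; linear_combination -3 * ei
        exact_mod_cast this)
      (by
        have : (j : ℝ) * (u ^ 2 + u * w + w ^ 2) = 3 * w := by
          rw [es, et] at ej; linear_combination -3 * ej
        exact_mod_cast this) bi bj
    rcases h with rfl | rfl | rfl <;> norm_num at es et
    · exact absurd es hs
    · subst es et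
      left; right; right; left; rw [hst]; module
    · subst es et
      right; right; right; left; rw [hst]; module

end RootSystemData

section WorkSec
open Filter Topology

def cell (P : Set (EucV ℓ)) (r : EucV ℓ → ℤ) : Set (EucV ℓ) :=
  {z | ∀ γ ∈ P, (r γ : ℝ) - 1 < ⟪γ, z⟫_ℝ ∧ ⟪γ, z⟫_ℝ < r γ}

theorem cell_convex (P : Set (EucV ℓ)) (r : EucV ℓ → ℤ) : Convex ℝ (cell P r) := by
  intro x hx y hy s t hs ht hst γ hγ
  obtain ⟨h1, h2⟩ := hx γ hγ
  obtain ⟨h3, h4⟩ := hy γ hγ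
  rw [inner_add_right, real_inner_smul_right, real_inner_smul_right]
  have := (convex_Ioo ((r γ : ℝ) - 1) (r γ)) (x := ⟪γ, x⟫_ℝ) ⟨h1, h2⟩ (y := ⟪γ, y⟫_ℝ)
    ⟨h3, h4⟩ hs ht hst
  simpa using this

theorem cell_comp (P : Set (EucV ℓ)) (r : EucV ℓ → ℤ) {z₀ : EucV ℓ} (h0 : z₀ ∈ cell P r) :
    z₀ ∈ Set.univ \ hypUnion Set.univ P ∧
    connectedComponentIn (Set.univ \ hypUnion Set.univ P) z₀ = cell P r := by
  have hsub : cell P r ⊆ Set.univ \ hypUnion Set.univ P := by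
    rintro z hz
    refine ⟨trivial, ?_⟩
    rintro ⟨_, γ, hγ, n, hn⟩
    obtain ⟨h1, h2⟩ := hz γ hγ
    rw [hn] at h1 h2
    have h1' : r γ - 1 < n := by exact_mod_cast h1
    have h2' : n < r γ := by exact_mod_cast h2
    omega
  refine ⟨hsub h0, Set.Subset.antisymm ?_ ?_⟩
  · intro z hz γ hγ
    have hpc := isPreconnected_connectedComponentIn (x := z₀)
      (F := Set.univ \ hypUnion Set.univ P)
    have him := hpc.image (fun y => ⟪γ, y⟫_ℝ) (by fun_prop)
    have hoc := him.ordConnected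
    have hm0 : ⟪γ, z₀⟫_ℝ ∈ (fun y => ⟪γ, y⟫_ℝ) ''
      connectedComponentIn (Set.univ \ hypUnion Set.univ P) z₀ :=
      ⟨z₀, mem_connectedComponentIn (hsub h0), rfl⟩
    have hm : ⟪γ, z⟫_ℝ ∈ (fun y => ⟪γ, y⟫_ℝ) ''
      connectedComponentIn (Set.univ \ hypUnion Set.univ P) z₀ := ⟨z, hz, rfl⟩
    have hno : ∀ n : ℤ, (n : ℝ) ∉ (fun y => ⟪γ, y⟫_ℝ) ''
      connectedComponentIn (Set.univ \ hypUnion Set.univ P) z₀ := by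
      rintro n ⟨y, hy, hyn⟩
      exact (connectedComponentIn_subset _ _ hy).2 ⟨trivial, γ, hγ, n, hyn⟩
    obtain ⟨h1, h2⟩ := h0 γ hγ
    constructor
    · by_contra hc
      push Not at hc
      apply hno (r γ - 1)
      push_cast
      exact hoc.out hm hm0 ⟨hc, h1.le⟩
    · by_contra hc
      push Not at hc
      exact hno (r γ) (hoc.out hm0 hm ⟨h2.le, hc⟩)
  · exact (cell_convex P r).isPreconnected.subset_connectedComponentIn h0 hsub

theorem alcove_eq_cell {P A : Set (EucV ℓ)} {r : EucV ℓ → ℤ} (hA : IsAlcove Set.univ P A)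
    (hr : IsAddress P A r) : A = cell P r ∧ A.Nonempty := by
  obtain ⟨x, hx, rfl⟩ := hA
  have hxm := mem_connectedComponentIn hx
  exact ⟨(cell_comp P r (fun γ hγ => hr γ hγ x hxm)).2, x, hxm⟩

theorem cell_isAlcove {P : Set (EucV ℓ)} {r : EucV ℓ → ℤ} {z₀ : EucV ℓ} (h0 : z₀ ∈ cell P r) :
    IsAlcove Set.univ P (cell P r) :=
  ⟨z₀, (cell_comp P r h0).1, (cell_comp P r h0).2.symm⟩

theorem cell_address (P : Set (EucV ℓ)) (r : EucV ℓ → ℤ) : IsAddress P (cell P r) r :=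
  fun γ hγ _ hx => hx γ hγ

theorem closure_cell_le {P : Set (EucV ℓ)} {r : EucV ℓ → ℤ} {z : EucV ℓ}
    (hz : z ∈ closure (cell P r)) {γ : EucV ℓ} (hγ : γ ∈ P) : ⟪γ, z⟫_ℝ ≤ r γ := by
  have hc : IsClosed {z : EucV ℓ | ⟪γ, z⟫_ℝ ≤ r γ} :=
    isClosed_le (by fun_prop) continuous_const
  exact closure_minimal (fun y hy => (hy γ hγ).2.le) hc hz

theorem mem_closure_cell {P : Set (EucV ℓ)} {r : EucV ℓ → ℤ} {z₀ z : EucV ℓ}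
    (h0 : z₀ ∈ cell P r) (hz : ∀ γ ∈ P, (r γ : ℝ) - 1 < ⟪γ, z⟫_ℝ ∧ ⟪γ, z⟫_ℝ ≤ r γ) :
    z ∈ closure (cell P r) := by
  have ht : Tendsto (fun t : ℝ => z + t • (z₀ - z)) (𝓝[>] 0) (𝓝 z) := by
    have : Tendsto (fun t : ℝ => z + t • (z₀ - z)) (𝓝 0) (𝓝 (z + (0 : ℝ) • (z₀ - z))) :=
      Continuous.tendsto (by fun_prop) 0
    rw [zero_smul, add_zero] at this
    exact this.mono_left nhdsWithin_le_nhds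
  refine mem_closure_of_tendsto ht ?_
  filter_upwards [Ioo_mem_nhdsGT (zero_lt_one' ℝ)] with t ht γ hγ
  obtain ⟨h1, h2⟩ := h0 γ hγ
  obtain ⟨h3, h4⟩ := hz γ hγ
  rw [inner_add_right, real_inner_smul_right, inner_sub_right]
  obtain ⟨t0, t1⟩ := ht
  constructor <;> nlinarith

/-- small perturbations -/
theorem ev_lt (p q s : ℝ) (h : p < s ∨ (p = s ∧ q < 0)) :
    ∀ᶠ t in 𝓝[>] (0 : ℝ), p + t * q < s := by
  rcases h with h | ⟨rfl, h⟩
  · have : Tendsto (fun t : ℝ => p + t * q) (𝓝 0) (𝓝 (p + 0 * q)) :=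
      Continuous.tendsto (by fun_prop) 0
    rw [zero_mul, add_zero] at this
    exact (this.mono_left nhdsWithin_le_nhds).eventually_lt_const h
  · filter_upwards [self_mem_nhdsWithin] with t ht
    have : (0 : ℝ) < t := ht
    nlinarith

theorem ev_gt (p q s : ℝ) (h : s < p) :
    ∀ᶠ t in 𝓝[>] (0 : ℝ), s < p + t * q := by
  filter_upwards [ev_lt (-p) (-q) (-s) (Or.inl (by linarith))] with t ht
  linarith

namespace RootSystemData

/-- the alcove below a point -/
theorem cell_at (rs : RootSystemData ℓ) (x : EucV ℓ) :
    ∃ z₀, z₀ ∈ cell rs.Pos (fun γ => ⌈⟪γ, x⟫_ℝ⌉) := by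
  obtain ⟨v, hv, -⟩ := rs.exists_ht
  have : ∀ᶠ t in 𝓝[>] (0 : ℝ), ∀ γ ∈ rs.Pos, ((⌈⟪γ, x⟫_ℝ⌉ : ℤ) : ℝ) - 1 < ⟪γ, x⟫_ℝ + t * (-⟪γ, v⟫_ℝ) ∧
      ⟪γ, x⟫_ℝ + t * (-⟪γ, v⟫_ℝ) < (⌈⟪γ, x⟫_ℝ⌉ : ℤ) := by
    rw [Filter.eventually_all_finite rs.pos_finite]
    intro γ hγ
    refine (ev_gt _ _ _ ?_).and (ev_lt _ _ _ ?_)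
    · linarith [Int.ceil_lt_add_one ⟪γ, x⟫_ℝ]
    · rcases (Int.le_ceil ⟪γ, x⟫_ℝ).lt_or_eq with h | h
      · exact Or.inl h
      · right
        obtain ⟨n, hn, h1⟩ := hv γ hγ
        have : (1 : ℝ) ≤ n := by exact_mod_cast hn
        exact ⟨h, by linarith⟩
  obtain ⟨t, ht⟩ := this.exists
  refine ⟨x + t • (-v), fun γ hγ => ?_⟩
  rw [inner_add_right, real_inner_smul_right, inner_neg_right]
  exact ht γ hγ

/-- generic point of a flat -/
theorem exists_generic (rs : RootSystemData ℓ) (α β : EucV ℓ) :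
    ∃ y : EucV ℓ, ⟪α, y⟫_ℝ = 0 ∧ ⟪β, y⟫_ℝ = 0 ∧
      ∀ γ ∈ rs.Φ, (∃ n : ℤ, ⟪γ, y⟫_ℝ = n) →
        ∀ x : EucV ℓ, ⟪α, x⟫_ℝ = 0 ∧ ⟪β, x⟫_ℝ = 0 → ⟪γ, x⟫_ℝ = 0 := by
  -- nonvanishing point
  have key : ∀ s : Finset (EucV ℓ), (∀ γ ∈ s, ∃ x : EucV ℓ, ⟪α, x⟫_ℝ = 0 ∧ ⟪β, x⟫_ℝ = 0 ∧
      ⟪γ, x⟫_ℝ ≠ 0) → ∃ y : EucV ℓ, ⟪α, y⟫_ℝ = 0 ∧ ⟪β, y⟫_ℝ = 0 ∧ ∀ γ ∈ s, ⟪γ, y⟫_ℝ ≠ 0 := by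
    classical
    intro s
    induction s using Finset.induction_on with
    | empty => intro _; exact ⟨0, by simp, by simp, by simp⟩
    | insert δ s hδ ih =>
      intro h
      obtain ⟨y, y1, y2, y3⟩ := ih (fun γ hγ => h γ (Finset.mem_insert_of_mem hγ))
      obtain ⟨x, x1, x2, x3⟩ := h δ (Finset.mem_insert_self _ _)
      by_cases hy : ⟪δ, y⟫_ℝ = 0
      · have : ∀ᶠ t in 𝓝[>] (0 : ℝ), ∀ γ ∈ s, ⟪γ, y⟫_ℝ + t * ⟪γ, x⟫_ℝ ≠ 0 := by
          rw [Filter.eventually_all_finset]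
          intro γ hγ
          rcases lt_or_gt_of_ne (y3 γ hγ) with h' | h'
          · exact (ev_lt _ _ _ (Or.inl h')).mono fun t ht => ht.ne
          · exact (ev_gt _ _ _ h').mono fun t ht => ht.ne'
        obtain ⟨t, ht, ht0⟩ := (this.and self_mem_nhdsWithin).exists
        have ht0 : 0 < t := ht0
        refine ⟨y + t • x, ?_, ?_, ?_⟩
        · simp [inner_add_right, real_inner_smul_right, y1, x1]
        · simp [inner_add_right, real_inner_smul_right, y2, x2]
        · intro γ hγ
          rw [inner_add_right, real_inner_smul_right]
          rcases Finset.mem_insert.1 hγ with rfl | hγ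
          · rw [hy, zero_add]; exact mul_ne_zero ht0.ne' x3
          · exact ht γ hγ
      · refine ⟨y, y1, y2, fun γ hγ => ?_⟩
        rcases Finset.mem_insert.1 hγ with rfl | hγ
        · exact hy
        · exact y3 γ hγ
  have hfin : {γ ∈ rs.Φ | ∃ x : EucV ℓ, ⟪α, x⟫_ℝ = 0 ∧ ⟪β, x⟫_ℝ = 0 ∧
      ⟪γ, x⟫_ℝ ≠ 0}.Finite := rs.finite.subset (fun _ h => h.1)
  obtain ⟨y, y1, y2, y3⟩ := key hfin.toFinset (fun γ hγ => by
    rw [Set.Finite.mem_toFinset] at hγ; exact hγ.2)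
  have : ∀ᶠ t in 𝓝[>] (0 : ℝ), ∀ γ ∈ rs.Φ, 0 + t * ⟪γ, y⟫_ℝ < 1 ∧ -1 < 0 + t * ⟪γ, y⟫_ℝ := by
    rw [Filter.eventually_all_finite rs.finite]
    intro γ _
    exact (ev_lt _ _ _ (Or.inl (by norm_num))).and (ev_gt _ _ _ (by norm_num))
  obtain ⟨t, ht, ht0⟩ := (this.and self_mem_nhdsWithin).exists
  have ht0 : 0 < t := ht0
  refine ⟨t • y, ?_, ?_, ?_⟩
  · rw [real_inner_smul_right, y1, mul_zero]
  · rw [real_inner_smul_right, y2, mul_zero]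
  · rintro γ hγ ⟨n, hn⟩ x ⟨x1, x2⟩
    by_contra hx
    have hne := y3 γ (by rw [Set.Finite.mem_toFinset]; exact ⟨hγ, x, x1, x2, hx⟩)
    rw [real_inner_smul_right] at hn
    obtain ⟨h1, h2⟩ := ht γ hγ
    rw [zero_add, hn] at h1 h2
    have h1' : n < 1 := by exact_mod_cast h1
    have h2' : -1 < n := by exact_mod_cast h2
    have : n = 0 := by omega
    subst this
    apply mul_ne_zero ht0.ne' hne
    simpa using hn

theorem forward (rs : RootSystemData ℓ) (S : Set (EucV ℓ)) (hS : S ⊆ rs.Pos)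
    (hW : WCompat Set.univ rs.Pos rs.Δ S) : TwoLocallySimple rs S := by
  intro X hX _
  rw [or_iff_not_imp_right]
  intro hne
  obtain ⟨α, hαS, hαX⟩ := Set.nonempty_iff_ne_empty.2 hne
  obtain ⟨a, ha, b, hb, hnp, rfl⟩ := hX
  obtain ⟨y, y1, y2, y3⟩ := rs.exists_generic a b
  obtain ⟨lam, hlam⟩ := rs.exists_dual (fun c => ((1 - ⌈⟪c, y⟫_ℝ⌉ : ℤ) : ℝ))
  have hint := rs.inner_int lam (fun c hc => ⟨_, hlam c hc⟩)
  set x := y + lam with hx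
  -- integrality
  have I1 : ∀ γ ∈ rs.locΦ {x : EucV ℓ | ⟪a, x⟫_ℝ = 0 ∧ ⟪b, x⟫_ℝ = 0},
      ⟪γ, x⟫_ℝ = ((⌈⟪γ, x⟫_ℝ⌉ : ℤ) : ℝ) := by
    intro γ hγ
    obtain ⟨n, hn⟩ := hint γ hγ.1
    have : ⟪γ, x⟫_ℝ = n := by rw [hx, inner_add_right, hγ.2 y ⟨y1, y2⟩, hn, zero_add]
    rw [this, Int.ceil_intCast]
  have I2 : ∀ γ ∈ rs.Φ, (∃ n : ℤ, ⟪γ, x⟫_ℝ = n) →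
      γ ∈ rs.locΦ {x : EucV ℓ | ⟪a, x⟫_ℝ = 0 ∧ ⟪b, x⟫_ℝ = 0} := by
    rintro γ hγ ⟨n, hn⟩
    refine ⟨hγ, y3 γ hγ ?_⟩
    obtain ⟨m, hm⟩ := hint γ hγ
    refine ⟨n - m, ?_⟩
    rw [hx, inner_add_right, hm] at hn
    push_cast; linarith
  set r : EucV ℓ → ℤ := fun γ => ⌈⟪γ, x⟫_ℝ⌉ with hr
  obtain ⟨z₀, hz₀⟩ := rs.cell_at x
  have hsub : cell rs.Pos r ⊆ fundPar Set.univ rs.Δ := by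
    intro z hz
    refine ⟨trivial, fun c hc => ?_⟩
    obtain ⟨h1, h2⟩ := hz c (rs.simple_pos hc)
    have hrc : r c = 1 := by
      rw [hr]
      simp only [hx, inner_add_right, hlam c hc]
      rw [Int.ceil_add_intCast]; ring
    rw [hrc] at h1 h2
    push_cast at h1 h2
    constructor <;> linarith
  have hxw : ∀ γ ∈ rs.Pos, (r γ : ℝ) - 1 < ⟪γ, x⟫_ℝ ∧ ⟪γ, x⟫_ℝ ≤ r γ := fun γ _ =>
    ⟨by linarith [Int.ceil_lt_add_one ⟪γ, x⟫_ℝ], Int.le_ceil _⟩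
  have hxc : x ∈ closure (cell rs.Pos r) := mem_closure_cell hz₀ hxw
  have hxu : x ∈ upperClos rs.Pos (cell rs.Pos r) r := ⟨hxc, fun γ hγ => (hxw γ hγ).1⟩
  have hxF : x ∈ upperClos rs.Pos (cell rs.Pos r) r ∩ {x : EucV ℓ | ⟪α, x⟫_ℝ = (r α : ℝ)} :=
    ⟨hxu, I1 α hαX.2⟩
  rcases hW _ (cell_isAlcove hz₀) hsub r (cell_address _ _) α hαS (r α) with h | h
  · rw [h] at hxF; exact absurd hxF (Set.notMem_empty _)
  obtain ⟨β, hβS, m, hm, -, hwall, hFsub⟩ := h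
  have hβx : ⟪β, x⟫_ℝ = m := hFsub hxF
  have hβpos := hS hβS
  have hβX := I2 β hβpos.1 ⟨m, hβx⟩
  refine ⟨β, ⟨hβS, hβpos, hβX⟩, ⟨hβpos, hβX⟩, ?_⟩
  rintro ⟨β₁, hβ₁, β₂, hβ₂, hsum⟩
  have e1 := I1 β₁ hβ₁.2
  have e2 := I1 β₂ hβ₂.2
  -- affine span in hyperplane
  have hspan : ∀ w : EucV ℓ, ⟪β, w⟫_ℝ = 0 → ⟪β₁, w⟫_ℝ = 0 := by
    intro w hw
    have hmem := hwall (x + w) trivial (by rw [inner_add_right, hβx, hw, add_zero])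
    let T : AffineSubspace ℝ (EucV ℓ) :=
      AffineSubspace.mk' x (LinearMap.ker (innerₗ (EucV ℓ) β₁))
    have hT : affineSpan ℝ ({x ∈ (Set.univ : Set (EucV ℓ)) | ⟪β, x⟫_ℝ = (m : ℝ)} ∩
        closure (cell rs.Pos r)) ≤ T := by
      rw [affineSpan_le]
      rintro z ⟨⟨_, hz⟩, hzc⟩
      have f1 := closure_cell_le hzc hβ₁.1
      have f2 := closure_cell_le hzc hβ₂.1
      have f3 : ⟪β₁, z⟫_ℝ + ⟪β₂, z⟫_ℝ = ⟪β₁, x⟫_ℝ + ⟪β₂, x⟫_ℝ := by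
        rw [← inner_add_left, ← inner_add_left, ← hsum, hz, hβx]
      have f4 : ⟪β₁, z⟫_ℝ = ⟪β₁, x⟫_ℝ := by
        simp only [hr] at f1 f2
        linarith
      simp only [T, SetLike.mem_coe, AffineSubspace.mem_mk', LinearMap.mem_ker, innerₗ_apply_apply,
        vsub_eq_sub, inner_sub_right, f4, sub_self]
    have := hT hmem
    simpa [T, AffineSubspace.mem_mk'] using this
  have hNβ := rs.norm_pos hβpos.1
  have hprop : β₁ = (⟪β, β₁⟫_ℝ / ⟪β, β⟫_ℝ) • β := by
    set c := ⟪β, β₁⟫_ℝ / ⟪β, β⟫_ℝ with hc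
    have h1 : ⟪β, β₁ - c • β⟫_ℝ = 0 := by
      rw [inner_sub_right, real_inner_smul_right, hc, div_mul_cancel₀ _ hNβ.ne', sub_self]
    have h2 := hspan _ h1
    rw [← sub_eq_zero, ← inner_self_eq_zero (𝕜 := ℝ), inner_sub_left, real_inner_smul_left, h1, h2]
    simp
  obtain ⟨v, hv, -⟩ := rs.exists_ht
  obtain ⟨n1, hn1, k1⟩ := hv β₁ hβ₁.1
  obtain ⟨n2, hn2, k2⟩ := hv β₂ hβ₂.1
  have hn1' : (1 : ℝ) ≤ n1 := by exact_mod_cast hn1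
  have hn2' : (1 : ℝ) ≤ n2 := by exact_mod_cast hn2
  have kβ : ⟪β, v⟫_ℝ = n1 + n2 := by rw [hsum, inner_add_left, k1, k2]
  rcases rs.reduced β hβpos.1 _ (hprop ▸ hβ₁.1.1) with h | h
  · rw [h, one_smul] at hprop
    rw [hprop, kβ] at k1
    linarith
  · rw [h, neg_one_smul] at hprop
    rw [hprop, inner_neg_left, kβ] at k1
    linarith

end RootSystemData

namespace RootSystemData

theorem pos_of_ht (rs : RootSystemData ℓ) {v : EucV ℓ}
    (hv : ∀ α ∈ rs.Pos, ∃ n : ℕ, 1 ≤ n ∧ ⟪α, v⟫_ℝ = n)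
    {α : EucV ℓ} (hα : α ∈ rs.Pos) : 1 ≤ ⟪α, v⟫_ℝ := by
  obtain ⟨n, hn, h⟩ := hv α hα
  rw [h]; exact_mod_cast hn

theorem sub_root (rs : RootSystemData ℓ) {a b : EucV ℓ} (ha : a ∈ rs.Φ) (hb : b ∈ rs.Φ)
    (hnp : NP b a) (h : 0 < ⟪a, b⟫_ℝ) : a - b ∈ rs.Φ := by
  obtain ⟨k, hk⟩ := rs.cryst b hb a ha
  obtain ⟨l, hl⟩ := rs.cryst a ha b hb
  have hb0 : b ≠ 0 := by rintro rfl; exact rs.nonzero hb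
  have hcs := cs_strict hb0 hnp
  have hN := rs.norm_pos hb
  have hM := rs.norm_pos ha
  have hk0 : 0 < k := by
    have : (0 : ℝ) < k := by by_contra hc; push Not at hc; nlinarith
    exact_mod_cast this
  rw [real_inner_comm] at hl hcs
  have hl0 : 0 < l := by
    have : (0 : ℝ) < l := by by_contra hc; push Not at hc; nlinarith
    exact_mod_cast this
  have e : ((k * l : ℤ) : ℝ) * (⟪b, b⟫_ℝ * ⟪a, a⟫_ℝ) = 4 * ⟪a, b⟫_ℝ ^ 2 := by
    push_cast
    linear_combination (-(l : ℝ) * ⟪a, a⟫_ℝ) * hk - 2 * ⟪a, b⟫_ℝ * hl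
  have h4 : k * l < 4 := by
    have : ((k * l : ℤ) : ℝ) < 4 := by
      by_contra hc
      push Not at hc
      nlinarith [mul_pos hN hM]
    exact_mod_cast this
  have : k = 1 ∨ l = 1 := by
    by_contra hc
    push Not at hc
    have : 2 ≤ k := by omega
    have : 2 ≤ l := by omega
    nlinarith
  rcases this with rfl | rfl
  · have := rs.refl_int hb ha hk
    simpa using this
  · have := rs.refl_int ha hb (k := 1) (by rw [real_inner_comm, hl]; simp)
    have := rs.neg_mem _ this
    simpa using this

/-- positive roots with integral value at `x` -/
def PI (rs : RootSystemData ℓ) (x : EucV ℓ) : Set (EucV ℓ) :=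
  {γ ∈ rs.Pos | ∃ n : ℤ, ⟪γ, x⟫_ℝ = n}

theorem PI_step (rs : RootSystemData ℓ) {x β γ : EucV ℓ} (hβ : β ∈ simplesOf (rs.PI x))
    (hγ : γ ∈ rs.PI x) (h : γ - β ∈ rs.Φ) : γ - β ∈ rs.PI x := by
  obtain ⟨v, hv, hpn⟩ := rs.exists_ht
  obtain ⟨n, hn⟩ := hβ.1.2
  obtain ⟨m, hm⟩ := hγ.2
  rcases hpn _ h with h' | h'
  · exact ⟨h', m - n, by rw [inner_sub_left, hn, hm]; push_cast; ring⟩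
  · exfalso
    apply hβ.2
    refine ⟨γ, hγ, -(γ - β), ⟨h', n - m, ?_⟩, by abel⟩
    rw [inner_neg_left, inner_sub_left, hn, hm]; push_cast; ring

theorem PI_refl (rs : RootSystemData ℓ) {x β : EucV ℓ} (hβ : β ∈ simplesOf (rs.PI x)) :
    ∀ k : ℕ, ∀ γ ∈ rs.PI x, γ ≠ β → 2 * ⟪γ, β⟫_ℝ = k * ⟪β, β⟫_ℝ → γ - (k : ℝ) • β ∈ rs.PI x := by
  intro k
  induction k using Nat.strong_induction_on with
  | _ k ih =>
  intro γ hγ hne hk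
  have hβΦ := hβ.1.1.1
  have hN := rs.norm_pos hβΦ
  have hrefl := rs.refl_int hβΦ hγ.1.1 hk
  match k, ih, hk, hrefl with
  | 0, _, _, _ => simpa using hγ
  | 1, _, _, hrefl =>
    simp only [Nat.cast_one, one_smul] at hrefl ⊢
    exact rs.PI_step hβ hγ hrefl
  | k + 2, ih, hk, hrefl =>
    obtain ⟨v, hv, hpn⟩ := rs.exists_ht
    have hnp : NP β γ := by
      rintro ⟨t, rfl⟩
      rcases rs.reduced β hβΦ t hγ.1.1 with rfl | rfl
      · exact hne (one_smul _ _)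
      · have h1 := rs.pos_of_ht hv hγ.1
        have h2 := rs.pos_of_ht hv hβ.1.1
        rw [real_inner_smul_left] at h1
        linarith
    have hpos : 0 < ⟪γ, β⟫_ℝ := by
      have : (0 : ℝ) < ((k + 2 : ℕ) : ℝ) * ⟪β, β⟫_ℝ := mul_pos (by positivity) hN
      linarith
    have h1 := rs.PI_step hβ hγ (rs.sub_root hγ.1.1 hβΦ hnp hpos)
    have h2 := ih k (by omega) (γ - β) h1
      (by
        intro h
        apply hnp
        exact ⟨2, by rw [sub_eq_iff_eq_add] at h; rw [h]; module⟩)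
      (by rw [inner_sub_left]; push_cast at hk; linarith)
    have h3 : γ - β - (k : ℝ) • β - β = γ - ((k + 2 : ℕ) : ℝ) • β := by
      push_cast; module
    rw [← h3]
    apply rs.PI_step hβ h2
    rw [h3]; exact hrefl

theorem exists_facet_dir (rs : RootSystemData ℓ) {x β : EucV ℓ}
    (hβ : β ∈ simplesOf (rs.PI x)) :
    ∃ y : EucV ℓ, ⟪β, y⟫_ℝ = 0 ∧ ∀ γ ∈ rs.PI x, γ ≠ β → 0 < ⟪γ, y⟫_ℝ := by
  obtain ⟨v, hv, hpn⟩ := rs.exists_ht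
  have hβΦ := hβ.1.1.1
  have hN := rs.norm_pos hβΦ
  have hvβ := rs.pos_of_ht hv hβ.1.1
  refine ⟨(2 : ℝ) • v - (2 * ⟪β, v⟫_ℝ / ⟪β, β⟫_ℝ) • β, ?_, ?_⟩
  · rw [inner_sub_right, real_inner_smul_right, real_inner_smul_right,
      div_mul_cancel₀ _ hN.ne', sub_self]
  · intro γ hγ hne
    have hvγ := rs.pos_of_ht hv hγ.1
    obtain ⟨k, hk⟩ := rs.cryst β hβΦ γ hγ.1.1
    have e : ⟪γ, (2 : ℝ) • v - (2 * ⟪β, v⟫_ℝ / ⟪β, β⟫_ℝ) • β⟫_ℝ =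
        2 * ⟪γ, v⟫_ℝ - k * ⟪β, v⟫_ℝ := by
      rw [inner_sub_right, real_inner_smul_right, real_inner_smul_right]
      have : ⟪γ, β⟫_ℝ = k * ⟪β, β⟫_ℝ / 2 := by linarith
      rw [this]
      field_simp
    rw [e]
    rcases le_or_gt k 0 with h | h
    · have : (k : ℝ) ≤ 0 := by exact_mod_cast h
      nlinarith
    · lift k to ℕ using h.le
      have h1 := rs.PI_refl hβ k γ hγ hne (by simpa using hk)
      have h2 := rs.pos_of_ht hv h1.1
      rw [inner_sub_left, real_inner_smul_left] at h2
      push_cast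
      linarith

theorem upper_int (rs : RootSystemData ℓ) {r : EucV ℓ → ℤ} {x γ : EucV ℓ}
    (hx : x ∈ upperClos rs.Pos (cell rs.Pos r) r) (hγ : γ ∈ rs.Pos)
    (h : ∃ n : ℤ, ⟪γ, x⟫_ℝ = n) : ⟪γ, x⟫_ℝ = r γ := by
  obtain ⟨n, hn⟩ := h
  have h1 := hx.2 γ hγ
  have h2 := closure_cell_le hx.1 hγ
  rw [hn] at h1 h2 ⊢
  have h1' : r γ - 1 < n := by exact_mod_cast h1
  have h2' : n ≤ r γ := by exact_mod_cast h2
  have : n = r γ := by omega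
  rw [this]

theorem isWall_of_simple (rs : RootSystemData ℓ) {r : EucV ℓ → ℤ} {x β z₀ : EucV ℓ}
    (h0 : z₀ ∈ cell rs.Pos r)
    (hx : x ∈ upperClos rs.Pos (cell rs.Pos r) r) (hβ : β ∈ simplesOf (rs.PI x)) :
    IsWall Set.univ β (r β) (cell rs.Pos r) := by
  obtain ⟨d, hd0, hd⟩ := rs.exists_facet_dir hβ
  have hβx := rs.upper_int hx hβ.1.1 hβ.1.2
  intro y _ hy
  have ev : ∀ᶠ t in 𝓝[>] (0 : ℝ), ∀ γ ∈ rs.Pos, (r γ : ℝ) - 1 < ⟪γ, x⟫_ℝ + t * (-⟪γ, d⟫_ℝ) ∧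
      (⟪γ, x⟫_ℝ + t * (-⟪γ, d⟫_ℝ) < r γ ∨ γ = β) := by
    rw [Filter.eventually_all_finite rs.pos_finite]
    intro γ hγ
    refine (ev_gt _ _ _ (hx.2 γ hγ)).and ?_
    by_cases hγβ : γ = β
    · exact Filter.Eventually.of_forall fun _ => Or.inr hγβ
    · refine (ev_lt _ _ _ ?_).mono fun _ h => Or.inl h
      rcases (closure_cell_le hx.1 hγ).lt_or_eq with h | h
      · exact Or.inl h
      · exact Or.inr ⟨h, by linarith [hd γ ⟨hγ, r γ, h⟩ hγβ]⟩
  obtain ⟨t, ht⟩ := ev.exists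
  set p := x + t • (-d) with hp
  have hpi : ∀ γ, ⟪γ, p⟫_ℝ = ⟪γ, x⟫_ℝ + t * (-⟪γ, d⟫_ℝ) := by
    intro γ
    rw [hp, inner_add_right, real_inner_smul_right, inner_neg_right]
  have hpβ : ⟪β, p⟫_ℝ = r β := by rw [hpi, hd0, hβx]; simp
  have ev2 : ∀ᶠ s in 𝓝[>] (0 : ℝ), ∀ γ ∈ rs.Pos,
      (r γ : ℝ) - 1 < ⟪γ, p⟫_ℝ + s * ⟪γ, y - p⟫_ℝ ∧
      (⟪γ, p⟫_ℝ + s * ⟪γ, y - p⟫_ℝ < r γ ∨ γ = β) := by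
    rw [Filter.eventually_all_finite rs.pos_finite]
    intro γ hγ
    obtain ⟨h1, h2⟩ := ht γ hγ
    rw [← hpi] at h1 h2
    refine (ev_gt _ _ _ h1).and ?_
    rcases h2 with h2 | h2
    · exact (ev_lt _ _ _ (Or.inl h2)).mono fun _ h => Or.inl h
    · exact Filter.Eventually.of_forall fun _ => Or.inr h2
  obtain ⟨s, hs, hs0⟩ := (ev2.and self_mem_nhdsWithin).exists
  have hs0 : 0 < s := hs0
  set q := p + s • (y - p) with hq
  have hqi : ∀ γ, ⟪γ, q⟫_ℝ = ⟪γ, p⟫_ℝ + s * ⟪γ, y - p⟫_ℝ := by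
    intro γ
    rw [hq, inner_add_right, real_inner_smul_right]
  have hqβ : ⟪β, q⟫_ℝ = r β := by rw [hqi, inner_sub_right, hpβ, hy]; simp
  have hpm : p ∈ {x ∈ (Set.univ : Set (EucV ℓ)) | ⟪β, x⟫_ℝ = (r β : ℝ)} ∩
      closure (cell rs.Pos r) := by
    refine ⟨⟨trivial, hpβ⟩, mem_closure_cell h0 fun γ hγ => ?_⟩
    obtain ⟨h1, h2⟩ := ht γ hγ
    rw [← hpi] at h1 h2
    refine ⟨h1, ?_⟩
    rcases h2 with h2 | rfl
    · exact h2.le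
    · exact hpβ.le
  have hqm : q ∈ {x ∈ (Set.univ : Set (EucV ℓ)) | ⟪β, x⟫_ℝ = (r β : ℝ)} ∩
      closure (cell rs.Pos r) := by
    refine ⟨⟨trivial, hqβ⟩, mem_closure_cell h0 fun γ hγ => ?_⟩
    obtain ⟨h1, h2⟩ := hs γ hγ
    rw [← hqi] at h1 h2
    refine ⟨h1, ?_⟩
    rcases h2 with h2 | rfl
    · exact h2.le
    · exact hqβ.le
  have := AffineMap.lineMap_mem s⁻¹ (subset_affineSpan ℝ _ hpm) (subset_affineSpan ℝ _ hqm)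
  convert this using 1
  rw [AffineMap.lineMap_apply, hq]
  simp only [vsub_eq_sub, vadd_eq_add, add_sub_cancel_left, smul_smul, inv_mul_cancel₀ hs0.ne',
    one_smul, sub_add_cancel]

theorem mem_span_of_loc {a b δ : EucV ℓ}
    (h : ∀ x ∈ {x : EucV ℓ | ⟪a, x⟫_ℝ = 0 ∧ ⟪b, x⟫_ℝ = 0}, ⟪δ, x⟫_ℝ = 0) :
    ∃ s t : ℝ, δ = s • a + t • b := by
  have : δ ∈ (Submodule.span ℝ {a, b})ᗮᗮ := by
    rw [Submodule.mem_orthogonal]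
    intro u hu
    rw [Submodule.mem_orthogonal] at hu
    rw [real_inner_comm]
    exact h u ⟨hu a (Submodule.subset_span (by simp)), hu b (Submodule.subset_span (by simp))⟩
  rw [Submodule.orthogonal_orthogonal, Submodule.mem_span_pair] at this
  obtain ⟨s, t, h⟩ := this
  exact ⟨s, t, h.symm⟩

theorem loc_irred (rs : RootSystemData ℓ) {a b : EucV ℓ} (ha : a ∈ rs.Φ) (hb : b ∈ rs.Φ)
    (hab : a + b ∈ rs.Φ) :
    IrredSet (rs.locΦ {x : EucV ℓ | ⟪a, x⟫_ℝ = 0 ∧ ⟪b, x⟫_ℝ = 0}) := by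
  rintro ⟨S₁, S₂, ⟨d₁, hd₁⟩, ⟨d₂, hd₂⟩, hun, hort⟩
  set L := rs.locΦ {x : EucV ℓ | ⟪a, x⟫_ℝ = 0 ∧ ⟪b, x⟫_ℝ = 0} with hL
  have la : a ∈ L := ⟨ha, fun x hx => hx.1⟩
  have lb : b ∈ L := ⟨hb, fun x hx => hx.2⟩
  have lab : a + b ∈ L := ⟨hab, fun x hx => by rw [inner_add_left, hx.1, hx.2, add_zero]⟩
  have key : ∀ T₁ T₂ : Set (EucV ℓ), L = T₁ ∪ T₂ → (∀ p ∈ T₁, ∀ q ∈ T₂, ⟪p, q⟫_ℝ = 0) →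
      a + b ∈ T₁ → ∀ d ∈ T₂, False := by
    intro T₁ T₂ hT ho h1 d hd
    have ld : d ∈ L := hT ▸ Or.inr hd
    have hd1 := ho _ h1 d hd
    rw [inner_add_left] at hd1
    have hN := rs.norm_pos hab
    have hadd : ⟪a + b, a + b⟫_ℝ = ⟪a + b, a⟫_ℝ + ⟪a + b, b⟫_ℝ := inner_add_right _ _ _
    have hor : ⟪a, d⟫_ℝ = 0 ∧ ⟪b, d⟫_ℝ = 0 := by
      rw [hT] at la lb
      rcases la with la | la
      · have := ho a la d hd
        exact ⟨this, by linarith⟩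
      · rcases lb with lb | lb
        · have := ho b lb d hd
          exact ⟨by linarith, this⟩
        · exfalso
          rw [hadd, ho _ h1 _ la, ho _ h1 _ lb] at hN
          simp at hN
    have := ld.2 d hor
    exact (rs.norm_pos ld.1).ne' this
  have lab' := lab
  rw [hun] at lab'
  rcases lab' with h | h
  · exact key S₁ S₂ hun hort h d₂ hd₂
  · exact key S₂ S₁ (by rw [hun, Set.union_comm])
      (fun p hp q hq => by rw [real_inner_comm]; exact hort q hq p hp) h d₁ hd₁

theorem exists_simple (rs : RootSystemData ℓ) (hG : rs.NoG2) {S : Set (EucV ℓ)}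
    (hS : S ⊆ rs.Pos) (hT : TwoLocallySimple rs S) {x α : EucV ℓ} (hα : α ∈ S)
    (hαx : α ∈ rs.PI x) : ∃ β ∈ S, β ∈ simplesOf (rs.PI x) := by
  obtain ⟨v, hv, hpn⟩ := rs.exists_ht
  have hfin : (S ∩ rs.PI x).Finite := rs.pos_finite.subset (fun _ h => hS h.1)
  obtain ⟨β, ⟨hβS, hβx⟩, hmin⟩ := Set.exists_min_image _ (fun γ => ⟪γ, v⟫_ℝ) hfin ⟨α, hα, hαx⟩
  refine ⟨β, hβS, hβx, ?_⟩
  rintro ⟨a, ha, b, hb, rfl⟩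
  have ha1 := rs.pos_of_ht hv ha.1
  have hb1 := rs.pos_of_ht hv hb.1
  have hab := hβx.1
  have hnp : NP a b := by
    rintro ⟨t, rfl⟩
    rcases rs.reduced a ha.1.1 t hb.1.1 with rfl | rfl
    · refine rs.not_mul ha.1.1 2 (by norm_num) (by norm_num) ?_
      convert hab.1 using 1
      module
    · rw [real_inner_smul_left] at hb1
      linarith
  have la : a ∈ rs.locPos {x : EucV ℓ | ⟪a, x⟫_ℝ = 0 ∧ ⟪b, x⟫_ℝ = 0} :=
    ⟨ha.1, ha.1.1, fun x hx => hx.1⟩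
  have lb : b ∈ rs.locPos {x : EucV ℓ | ⟪a, x⟫_ℝ = 0 ∧ ⟪b, x⟫_ℝ = 0} :=
    ⟨hb.1, hb.1.1, fun x hx => hx.2⟩
  have lab : a + b ∈ rs.locPos {x : EucV ℓ | ⟪a, x⟫_ℝ = 0 ∧ ⟪b, x⟫_ℝ = 0} :=
    ⟨hab, hab.1, fun x hx => by rw [inner_add_left, hx.1, hx.2, add_zero]⟩
  rcases hT _ ⟨a, ha.1, b, hb.1, hnp, rfl⟩ (rs.loc_irred ha.1.1 hb.1.1 hab.1) with h | h
  swap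
  · have : a + b ∈ (∅ : Set (EucV ℓ)) := h ▸ ⟨hβS, lab⟩
    exact this
  obtain ⟨σ, ⟨hσS, hσP⟩, hσΔ⟩ := h
  obtain ⟨s, t, hst⟩ := mem_span_of_loc hσP.2.2
  have hσ1 := rs.pos_of_ht hv hσP.1
  obtain ⟨m, hm⟩ := ha.2
  obtain ⟨n, hn⟩ := hb.2
  have fin : (∃ k : ℤ, ⟪σ, x⟫_ℝ = k) → ⟪σ, v⟫_ℝ < ⟪a + b, v⟫_ℝ → False := by
    intro h1 h2
    have := hmin σ ⟨hσS, hσP.1, h1⟩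
    linarith
  rw [inner_add_left] at fin
  rcases rs.rank2 hG ha.1.1 hb.1.1 hab.1 hnp hσP.1.1 hst with h | h
  · rcases h with rfl | rfl | rfl | rfl | rfl | rfl
    · exact fin ⟨m, hm⟩ (by linarith)
    · exact fin ⟨n, hn⟩ (by linarith)
    · exact hσΔ.2 ⟨a, la, b, lb, rfl⟩
    · refine fin ⟨m - n, by rw [inner_sub_left, hm, hn]; push_cast; ring⟩ ?_
      rw [inner_sub_left]; linarith
    · exact hσΔ.2 ⟨a, la, a + b, lab, by module⟩
    · exact hσΔ.2 ⟨a + b, lab, b, lb, by module⟩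
  · have hneg : ⟪-σ, v⟫_ℝ ≤ -1 := by rw [inner_neg_left]; linarith
    rcases h with h | h | h | h | h | h
    · rw [h] at hneg; linarith
    · rw [h] at hneg; linarith
    · rw [h, inner_add_left] at hneg; linarith
    · have e : σ = b - a := by rw [← neg_neg σ, h]; abel
      refine fin ⟨n - m, by rw [e, inner_sub_left, hm, hn]; push_cast; ring⟩ ?_
      rw [e, inner_sub_left]; linarith
    · rw [h, inner_add_left, real_inner_smul_left] at hneg; linarith
    · rw [h, inner_add_left, real_inner_smul_left] at hneg; linarith

theorem backward (rs : RootSystemData ℓ) (hG : rs.NoG2) (S : Set (EucV ℓ)) (hS : S ⊆ rs.Pos)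
    (hT : TwoLocallySimple rs S) : WCompat Set.univ rs.Pos rs.Δ S := by
  intro A hA hsub r hr α hα n
  obtain ⟨rfl, z₀, hz₀⟩ := alcove_eq_cell hA hr
  rw [or_iff_not_imp_left]
  intro hne
  set F := upperClos rs.Pos (cell rs.Pos r) r ∩ {x : EucV ℓ | ⟪α, x⟫_ℝ = (n : ℝ)} with hF
  have hne' : F.Nonempty := Set.nonempty_iff_ne_empty.2 hne
  let Z : EucV ℓ → Set (EucV ℓ) := fun x => {γ ∈ rs.Pos | ⟪γ, x⟫_ℝ = r γ}
  have hZfin : ∀ x, (Z x).Finite := fun x => rs.pos_finite.subset (fun _ h => h.1)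
  obtain ⟨x, hxF, hmin⟩ := (measure fun x => (Z x).ncard).wf.has_min F hne'
  have hZ : ∀ y ∈ F, Z x ⊆ Z y := by
    intro y hy
    set w := (1 / 2 : ℝ) • x + (1 / 2 : ℝ) • y with hw
    have hwi : ∀ γ, ⟪γ, w⟫_ℝ = (⟪γ, x⟫_ℝ + ⟪γ, y⟫_ℝ) / 2 := by
      intro γ
      rw [hw, inner_add_right, real_inner_smul_right, real_inner_smul_right]; ring
    have hwF : w ∈ F := by
      refine ⟨⟨?_, fun γ hγ => ?_⟩, ?_⟩
      · exact (cell_convex rs.Pos r).closure hxF.1.1 hy.1.1 (by norm_num) (by norm_num)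
          (by norm_num)
      · rw [hwi]; linarith [hxF.1.2 γ hγ, hy.1.2 γ hγ]
      · have h1 : ⟪α, x⟫_ℝ = n := hxF.2
        have h2 : ⟪α, y⟫_ℝ = n := hy.2
        change ⟪α, w⟫_ℝ = n
        rw [hwi, h1, h2]; ring
    have hsub' : ∀ γ ∈ Z w, γ ∈ Z x ∧ γ ∈ Z y := by
      rintro γ ⟨hγ, h⟩
      rw [hwi] at h
      have h1 := closure_cell_le hxF.1.1 hγ
      have h2 := closure_cell_le hy.1.1 hγ
      exact ⟨⟨hγ, by linarith⟩, ⟨hγ, by linarith⟩⟩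
    have hle : (Z x).ncard ≤ (Z w).ncard := by
      have := hmin w hwF
      simpa [measure, invImage, InvImage, WellFoundedRelation.rel] using this
    have heq : Z w = Z x := Set.eq_of_subset_of_ncard_le (fun γ h => (hsub' γ h).1) hle (hZfin x)
    rw [← heq]
    exact fun γ h => (hsub' γ h).2
  obtain ⟨β, hβS, hβ⟩ := rs.exists_simple hG hS hT hα (x := x) ⟨hS hα, n, hxF.2⟩
  have hβx := rs.upper_int hxF.1 hβ.1.1 hβ.1.2
  refine ⟨β, hβS, r β, rfl, ?_, rs.isWall_of_simple hz₀ hxF.1 hβ, ?_⟩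
  · have h1 := (hz₀ β hβ.1.1).2
    have h2 : 0 ≤ ⟪β, z₀⟫_ℝ := by
      obtain ⟨s, c, hs, e⟩ := hβ.1.1.2
      rw [e, sum_inner]
      refine Finset.sum_nonneg fun b hb => ?_
      rw [real_inner_smul_left]
      exact mul_nonneg (Nat.cast_nonneg _) ((hsub hz₀).2 b (hs hb)).1.le
    have : (0 : ℝ) < r β := by linarith
    have : 0 < r β := by exact_mod_cast this
    omega
  · intro y hy
    exact (hZ y hy ⟨hβ.1.1, hβx⟩).2

end RootSystemData


end WorkSec

/-- Let `Φ` be an irreducible crystallographic root system that is not of type `G₂`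
(equivalently, not of rank `2` with `|Φ⁺| = 6`). A subset `Σ ⊆ Φ⁺` is
Worpitzky-compatible if and only if `Σ` is 2-locally simple. -/
theorem worpitzky_compatible_iff_two_locally_simple
    {ℓ : ℕ} (rs : RootSystemData ℓ) (hirr : IrredSet rs.Φ)
    (hG2 : ¬ (ℓ = 2 ∧ rs.Pos.ncard = 6))
    (S : Set (EucV ℓ)) (hS : S ⊆ rs.Pos) :
    WCompat Set.univ rs.Pos rs.Δ S ↔ TwoLocallySimple rs S := by
  exact ⟨rs.forward S hS, rs.backward (rs.noG2 hirr hG2) S hS⟩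

end
end

section
/- Let Φ be an irreducible crystallographic root system and suppose β, γ₁, γ₂ ∈ Φ⁺ with γ₁ ≠ γ₂ and γ₁ − γ₂ ∉ Φ. If β − γ₁ ∈ Φ⁺ and β − γ₂ ∈ Φ⁺, then either β = γ₁ + γ₂ or β − γ₁ − γ₂ ∈ Φ. -/
open scoped InnerProductSpace

noncomputable section

variable {ℓ : ℕ}

theorem sub_mem_of_inner_pos {ℓ : ℕ} (rs : RootSystemData ℓ) (a b : EucV ℓ)
    (ha : a ∈ rs.Φ) (hb : b ∈ rs.Φ) (h : 0 < ⟪a, b⟫_ℝ) : a = b ∨ a - b ∈ rs.Φ := by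
  have hba : ⟪b, a⟫_ℝ = ⟪a, b⟫_ℝ := real_inner_comm _ _
  have ha0 : a ≠ 0 := fun h0 => rs.nonzero (h0 ▸ ha)
  have hb0 : b ≠ 0 := fun h0 => rs.nonzero (h0 ▸ hb)
  have haa : 0 < ⟪a, a⟫_ℝ := real_inner_self_pos.2 ha0
  have hbb : 0 < ⟪b, b⟫_ℝ := real_inner_self_pos.2 hb0
  obtain ⟨n, hn⟩ := rs.cryst a ha b hb
  obtain ⟨m, hm⟩ := rs.cryst b hb a ha
  rw [hba] at hn
  have hn0 : 0 < n := by
    have : (0 : ℝ) < n := by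
      by_contra! hc
      nlinarith
    exact_mod_cast this
  have hm0 : 0 < m := by
    have : (0 : ℝ) < m := by
      by_contra! hc
      nlinarith
    exact_mod_cast this
  by_cases hn1 : n = 1
  · right
    have hr := rs.refl_mem a ha b hb
    rw [hba, hn, hn1] at hr
    have e : ((1 : ℤ) : ℝ) * ⟪a, a⟫_ℝ / ⟪a, a⟫_ℝ = 1 := by
      rw [Int.cast_one, one_mul, div_self haa.ne']
    rw [e, one_smul] at hr
    simpa using rs.neg_mem _ hr
  by_cases hm1 : m = 1
  · right
    have hr := rs.refl_mem b hb a ha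
    rw [hm, hm1] at hr
    have e : ((1 : ℤ) : ℝ) * ⟪b, b⟫_ℝ / ⟪b, b⟫_ℝ = 1 := by
      rw [Int.cast_one, one_mul, div_self hbb.ne']
    rwa [e, one_smul] at hr
  left
  have hn2 : (2 : ℝ) ≤ n := by exact_mod_cast (by omega : 2 ≤ n)
  have hm2 : (2 : ℝ) ≤ m := by exact_mod_cast (by omega : 2 ≤ m)
  have hz : ⟪a - b, a - b⟫_ℝ ≤ 0 := by
    rw [real_inner_sub_sub_self]
    nlinarith
  exact sub_eq_zero.1 (real_inner_self_nonpos.1 hz)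

/-- **Lemma 3.2 (generalized proximity).** Let `Φ` be an irreducible
crystallographic root system and `β, γ₁, γ₂ ∈ Φ⁺` with `γ₁ ≠ γ₂` and
`γ₁ - γ₂ ∉ Φ`. If `β - γ₁ ∈ Φ⁺` and `β - γ₂ ∈ Φ⁺`, then either `β = γ₁ + γ₂`
or `β - γ₁ - γ₂ ∈ Φ`. -/
theorem gen_proximity
    {ℓ : ℕ} (rs : RootSystemData ℓ) (hirr : IrredSet rs.Φ)
    (β γ₁ γ₂ : EucV ℓ) (hβ : β ∈ rs.Pos) (hγ₁ : γ₁ ∈ rs.Pos) (hγ₂ : γ₂ ∈ rs.Pos)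
    (hne : γ₁ ≠ γ₂) (hdiff : γ₁ - γ₂ ∉ rs.Φ)
    (h1 : β - γ₁ ∈ rs.Pos) (h2 : β - γ₂ ∈ rs.Pos) :
    β = γ₁ + γ₂ ∨ β - γ₁ - γ₂ ∈ rs.Φ := by
  have key := sub_mem_of_inner_pos rs
  have hβ0 : β ≠ 0 := fun h0 => rs.nonzero (h0 ▸ hβ.1)
  have hββ : 0 < ⟪β, β⟫_ℝ := real_inner_self_pos.2 hβ0
  by_cases c1 : 0 < ⟪β - γ₁, γ₂⟫_ℝ
  · rcases key _ _ h1.1 hγ₂.1 c1 with h | h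
    · left
      rw [← h]; abel
    · exact Or.inr h
  by_cases c2 : 0 < ⟪β - γ₂, γ₁⟫_ℝ
  · rcases key _ _ h2.1 hγ₁.1 c2 with h | h
    · left
      rw [← h]; abel
    · right
      rwa [sub_right_comm] at h
  exfalso
  have c3 : ¬ 0 < ⟪γ₁, γ₂⟫_ℝ := fun c => by
    rcases key _ _ hγ₁.1 hγ₂.1 c with h | h
    · exact hne h
    · exact hdiff h
  have c4 : ¬ 0 < ⟪β - γ₂, β - γ₁⟫_ℝ := fun c => by
    rcases key _ _ h2.1 h1.1 c with h | h
    · exact hne (sub_right_injective h).symm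
    · apply hdiff
      rwa [sub_sub_sub_cancel_left] at h
  have e1 := real_inner_comm β γ₁
  have e2 := real_inner_comm β γ₂
  have e3 := real_inner_comm γ₁ γ₂
  simp only [inner_sub_left, inner_sub_right] at c1 c2 c4
  linarith


end
end

section
/- Let Φ be the root system of type B₂ with simple roots α₁ (short) and α₂ (long). Then Σ = {2α₁+α₂, α₂} is negatively coclosed but not coclosed, and it is the unique subset of Φ⁺ that is negatively coclosed but not coclosed. -/
open scoped InnerProductSpace

noncomputable section

variable {ℓ : ℕ}

set_option maxHeartbeats 2000000

theorem B2_numbers (rs : RootSystemData 2) (a1 a2 : EucV 2)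
    (hΔ : rs.Δ = {a1, a2}) (hlen : ⟪a1, a1⟫_ℝ < ⟪a2, a2⟫_ℝ)
    (hPos : rs.Pos = {a1, a2, a1 + a2, (2:ℝ) • a1 + a2}) :
    (∀ p q r s : ℝ, p • a1 + q • a2 = r • a1 + s • a2 → p = r ∧ q = s) ∧
    0 < ⟪a1, a1⟫_ℝ ∧ ⟪a1, a2⟫_ℝ = - ⟪a1, a1⟫_ℝ ∧ ⟪a2, a2⟫_ℝ = 2 * ⟪a1, a1⟫_ℝ := by
  have hne : a1 ≠ a2 := by rintro rfl; exact lt_irrefl _ hlen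
  have hli := rs.simple_indep
  rw [hΔ] at hli
  have hli2 : ∀ p q : ℝ, p • a1 + q • a2 = 0 → p = 0 ∧ q = 0 := by
    have h := (LinearIndepOn.pair_iff (R := ℝ) (id : EucV 2 → EucV 2) hne).1 hli
    intro p q; exact h p q
  have hinj : ∀ p q r s : ℝ, p • a1 + q • a2 = r • a1 + s • a2 → p = r ∧ q = s := by
    intro p q r s h
    have := hli2 (p - r) (q - s) (by
      have h2 := sub_eq_zero.2 h
      rw [← h2]; module)
    constructor <;> linarith [this.1, this.2]
  have h1 : a1 ∈ rs.Φ := rs.simple_sub (by simp [hΔ])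
  have h2 : a2 ∈ rs.Φ := rs.simple_sub (by simp [hΔ])
  have h12 : a1 + a2 ∈ rs.Φ := by
    have : a1 + a2 ∈ rs.Pos := by simp [hPos]
    exact this.1
  have hx : 0 < ⟪a1, a1⟫_ℝ := by
    rw [real_inner_self_pos]
    rintro rfl; exact rs.nonzero h1
  have hP : ∀ p q : ℝ, p • a1 + q • a2 ∈ rs.Pos →
      (p = 1 ∧ q = 0) ∨ (p = 0 ∧ q = 1) ∨ (p = 1 ∧ q = 1) ∨ (p = 2 ∧ q = 1) := by
    intro p q h
    rw [hPos] at h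
    rcases h with h | h | h | h
    · exact Or.inl (hinj _ _ _ _ (h.trans (by module)))
    · exact Or.inr (Or.inl (hinj _ _ _ _ (h.trans (by module))))
    · exact Or.inr (Or.inr (Or.inl (hinj _ _ _ _ (h.trans (by module)))))
    · exact Or.inr (Or.inr (Or.inr (hinj _ _ _ _ (Eq.trans h (by module)))))
  have hΦ : ∀ p q : ℝ, p • a1 + q • a2 ∈ rs.Φ →
      ((p = 1 ∧ q = 0) ∨ (p = 0 ∧ q = 1) ∨ (p = 1 ∧ q = 1) ∨ (p = 2 ∧ q = 1)) ∨
      ((-p = 1 ∧ -q = 0) ∨ (-p = 0 ∧ -q = 1) ∨ (-p = 1 ∧ -q = 1) ∨ (-p = 2 ∧ -q = 1)) := by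
    intro p q h
    rcases rs.pos_or_neg _ h with h' | h'
    · exact Or.inl (hP _ _ ⟨h, h'⟩)
    · right
      apply hP
      have e : (-p) • a1 + (-q) • a2 = -(p • a1 + q • a2) := by module
      rw [e]
      exact ⟨rs.neg_mem _ h, h'⟩
  have r1 := rs.refl_mem _ h1 _ h2
  have r2 := rs.refl_mem _ h2 _ h1
  have r3 := rs.refl_mem _ h12 _ h1
  simp only [inner_add_left, inner_add_right] at r3
  rw [real_inner_comm] at r1
  rw [real_inner_comm a1 a2] at r3
  refine ⟨hinj, hx, ?_⟩
  generalize ⟪a1, a1⟫_ℝ = x at *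
  generalize ⟪a2, a2⟫_ℝ = y at *
  generalize ⟪a1, a2⟫_ℝ = z at *
  have hy : 0 < y := hx.trans hlen
  set n := 2 * z / x with hn
  set m := 2 * z / y with hm
  have en : n * x = 2 * z := by rw [hn]; field_simp
  have em : m * y = 2 * z := by rw [hm]; field_simp
  have r1' := hΦ (-n) 1 (by convert r1 using 1; module)
  have r2' := hΦ 1 (-m) (by convert r2 using 1; module)
  have hn3 : n = 0 ∨ n = -1 ∨ n = -2 := by grind
  have hm3 : m = 0 ∨ m = -1 := by grind
  rcases hn3 with h | h | h
  · have hz : z = 0 := by rw [h] at en; linarith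
    exfalso
    subst hz
    set k := 2 * (x + 0) / (x + 0 + (0 + y)) with hk
    have ek : k * (x + y) = 2 * x := by rw [hk]; simp; field_simp
    have r3' := hΦ (1 - k) (-k) (by convert r3 using 1; module)
    have hk0 : 0 < k := by
      by_contra hc
      nlinarith
    have hk1 : k < 1 := by
      by_contra hc
      nlinarith
    grind
  · exfalso
    rcases hm3 with h' | h' <;> rw [h] at en <;> rw [h'] at em <;> linarith
  · rcases hm3 with h' | h' <;> rw [h] at en <;> rw [h'] at em
    · linarith
    · constructor <;> linarith

/-- **Remark 1.9(a) for B₂.** Let `Φ` be the root system of type `B₂` with simple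
roots `a1` (short) and `a2` (long). Then `Σ = {2a1+a2, a2}` is negatively coclosed
but not coclosed, and it is the unique subset of `Φ⁺` with this property. -/
theorem B2_unique_negatively_coclosed_not_coclosed
    (rs : RootSystemData 2) (a1 a2 : EucV 2)
    (hΔ : rs.Δ = {a1, a2}) (hlen : ⟪a1, a1⟫_ℝ < ⟪a2, a2⟫_ℝ)
    (hPos : rs.Pos = {a1, a2, a1 + a2, (2:ℝ) • a1 + a2}) :
    (NegCoclosed rs.Pos {(2:ℝ) • a1 + a2, a2} ∧
      ¬ Coclosed rs.Pos {(2:ℝ) • a1 + a2, a2}) ∧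
    ∀ S : Set (EucV 2), S ⊆ rs.Pos → NegCoclosed rs.Pos S → ¬ Coclosed rs.Pos S →
      S = {(2:ℝ) • a1 + a2, a2} := by
  obtain ⟨hinj, hx, hz, hy⟩ := B2_numbers rs a1 a2 hΔ hlen hPos
  have hz' : ⟪a2, a1⟫_ℝ = - ⟪a1, a1⟫_ℝ := by rw [real_inner_comm]; exact hz
  have hneg : ∀ b ∈ rs.Pos, ∀ c ∈ rs.Pos, ⟪b, c⟫_ℝ < 0 →
      (b = a1 ∧ c = a2) ∨ (b = a2 ∧ c = a1) := by
    intro b hb c hc h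
    rw [hPos] at hb hc
    rcases hb with rfl | rfl | rfl | hb <;> rcases hc with rfl | rfl | rfl | hc <;>
      first
      | exact Or.inl ⟨rfl, rfl⟩
      | exact Or.inr ⟨rfl, rfl⟩
      | (exfalso
         try rw [Set.mem_singleton_iff] at hb
         try rw [Set.mem_singleton_iff] at hc
         try subst hb
         try subst hc
         try simp only [inner_add_left, inner_add_right, real_inner_smul_left,
           real_inner_smul_right, hz, hz', hy] at h
         linarith)
  have hcoord : ∀ b ∈ rs.Pos, ∃ p q : ℤ, b = (p : ℝ) • a1 + (q : ℝ) • a2 ∧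
      ((p = 1 ∧ q = 0 ∧ b = a1) ∨ (p = 0 ∧ q = 1 ∧ b = a2) ∨ (p = 1 ∧ q = 1 ∧ b = a1 + a2) ∨
        (p = 2 ∧ q = 1 ∧ b = (2:ℝ) • a1 + a2)) := by
    intro b hb
    rw [hPos] at hb
    rcases hb with h | h | h | h
    · exact ⟨1, 0, by rw [h]; push_cast; module, by simp [h]⟩
    · exact ⟨0, 1, by rw [h]; push_cast; module, by simp [h]⟩
    · exact ⟨1, 1, by rw [h]; push_cast; module, by simp [h]⟩
    · rw [Set.mem_singleton_iff] at h
      exact ⟨2, 1, by rw [h]; push_cast; module, by simp [h]⟩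
  have hne1 : ∀ p q r s : ℝ, (p ≠ r ∨ q ≠ s) → p • a1 + q • a2 ≠ r • a1 + s • a2 := by
    intro p q r s h e
    have := hinj _ _ _ _ e
    tauto
  have n1 : a1 ≠ (2:ℝ) • a1 + a2 := by
    have := hne1 1 0 2 1 (by norm_num)
    intro h; apply this; convert h using 1 <;> module
  have n2 : a1 ≠ a2 := by
    have := hne1 1 0 0 1 (by norm_num)
    intro h; apply this; convert h using 1 <;> module
  have n3 : a1 + a2 ≠ (2:ℝ) • a1 + a2 := by
    have := hne1 1 1 2 1 (by norm_num)
    intro h; apply this; convert h using 1 <;> module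
  have n4 : a1 + a2 ≠ a2 := by
    have := hne1 1 1 0 1 (by norm_num)
    intro h; apply this; convert h using 1 <;> module
  have m1 : a1 ∈ rs.Pos := by simp [hPos]
  have m2 : a2 ∈ rs.Pos := by simp [hPos]
  have m3 : a1 + a2 ∈ rs.Pos := by simp [hPos]
  have m4 : (2:ℝ) • a1 + a2 ∈ rs.Pos := by simp [hPos]
  refine ⟨⟨?_, ?_⟩, ?_⟩
  · intro α _ b hb c hc d₁ d₂ _ _ _ hlt
    rcases hneg b hb c hc hlt with h | h
    · right; right; exact h.2
    · left; right; exact h.1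
  · intro h
    have := h ((2:ℝ) • a1 + a2) (Or.inl rfl) a1 m1 (a1 + a2) m3 1 1 one_pos one_pos
      (by push_cast; module)
    rcases this with (h | h) | (h | h)
    · exact n1 h
    · exact n2 h
    · exact n3 h
    · exact n4 h
  · intro S hS hN hC
    unfold Coclosed at hC
    push Not at hC
    obtain ⟨α, hα, b, hb, c, hc, d, e, hd, he, heq, hbS, hcS⟩ := hC
    have key : α = (2:ℝ) • a1 + a2 ∧ a1 ∉ S ∧ a1 + a2 ∉ S := by
      obtain ⟨p, q, hpq, H1⟩ := hcoord α (hS hα)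
      obtain ⟨r, s, hrs, H2⟩ := hcoord b hb
      obtain ⟨t, u, htu, H3⟩ := hcoord c hc
      have E : (p : ℝ) • a1 + (q : ℝ) • a2 =
          ((d * r + e * t : ℤ) : ℝ) • a1 + ((d * s + e * u : ℤ) : ℝ) • a2 := by
        rw [← hpq, heq, hrs, htu]; push_cast; module
      obtain ⟨E1, E2⟩ := hinj _ _ _ _ E
      have E1' : p = d * r + e * t := by exact_mod_cast E1
      have E2' : q = d * s + e * u := by exact_mod_cast E2
      clear E E1 E2 hpq hrs htu
      have hnn : ¬ (b = a1 ∧ c = a2) := by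
        rintro ⟨rfl, rfl⟩
        have := hN α hα _ hb _ hc d e hd he heq (by rw [hz]; linarith)
        tauto
      have hnn' : ¬ (b = a2 ∧ c = a1) := by
        rintro ⟨rfl, rfl⟩
        have := hN α hα _ hb _ hc d e hd he heq (by rw [hz']; linarith)
        tauto
      clear heq
      rcases H2 with ⟨rfl, rfl, hb'⟩ | ⟨rfl, rfl, hb'⟩ | ⟨rfl, rfl, hb'⟩ | ⟨rfl, rfl, hb'⟩ <;>
      rcases H3 with ⟨rfl, rfl, hc'⟩ | ⟨rfl, rfl, hc'⟩ | ⟨rfl, rfl, hc'⟩ | ⟨rfl, rfl, hc'⟩ <;>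
      first
      | exact (hnn (And.intro hb' hc')).elim
      | exact (hnn' (And.intro hb' hc')).elim
      | (exfalso; omega)
      | (rcases H1 with ⟨hp, hq, ha⟩ | ⟨hp, hq, ha⟩ | ⟨hp, hq, ha⟩ | ⟨hp, hq, ha⟩ <;>
          first
          | (exfalso; omega)
          | (rw [hb'] at hbS; rw [hc'] at hcS
             first
             | exact ⟨ha, hbS, hcS⟩
             | exact ⟨ha, hcS, hbS⟩))
    obtain ⟨rfl, k1, k2⟩ := key
    have k3 : a2 ∈ S := by
      have := hN _ hα a1 m1 a2 m2 2 1 two_pos one_pos (by push_cast; module)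
        (by rw [hz]; linarith)
      tauto
    ext v
    constructor
    · intro hv
      have hv' := hS hv
      rw [hPos] at hv'
      rcases hv' with rfl | rfl | rfl | h
      · exact absurd hv k1
      · exact Or.inr rfl
      · exact absurd hv k2
      · exact Or.inl h
    · rintro (rfl | rfl)
      · exact hα
      · exact k3

end
end
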